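/- arXiv:2406.00173 — 3 statements merged into one kernel-verified Lean document; each statement's English description precedes it below -/
import Mathlib

section
/- The eta quotient f(z) = \eta(5z)^{10}/\eta(z)^2 is a holomorphic modular form of weight 4 for \Gamma_0(5) with q-expansion q^2 + 2q^3 + 5q^4 + 10q^5 + \cdots, i.e., it vanishes to order 2 at the cusp \infty. -/
noncomputable section
open Complex UpperHalfPlane Matrix ModularForm CongruenceSubgroup Filter
open scoped ModularForm MatrixGroups Manifold Real

namespace Grid

/-- `e^{2πiz}`. -/
def qc (z : ℂ) : ℂ := Complex.exp (2 * ↑Real.pi * Complex.I * z)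

/-- The quasimodular Eisenstein series `E₂(z) = 1 - 24 ∑ σ₁(n) qⁿ`. -/
def E2 (z : ℂ) : ℂ :=
  1 - 24 * ∑' n : ℕ+, (ArithmeticFunction.sigma 1 n : ℂ) * qc z ^ (n : ℕ)

/-- The Dedekind eta function `η(z) = q^{1/24} ∏ (1 - qⁿ)`. -/
def eta (z : ℂ) : ℂ :=
  Complex.exp (↑Real.pi * Complex.I * z / 12) * ∏' n : ℕ+, (1 - qc z ^ (n : ℕ))

/-- `f` has a Fourier expansion at `∞` in powers of `q^{1/h}` with coefficients `a`. -/
def HasExpansion (h : ℕ+) (f : ℍ → ℂ) (a : ℤ → ℂ) : Prop :=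
  ∀ z : ℍ, f z = ∑' n : ℤ, a n * Complex.exp (2 * ↑Real.pi * Complex.I * n * z / h)

/-- The coefficients vanish below some bound. -/
def CoeffsBddBelow (a : ℤ → ℂ) : Prop := ∃ N : ℤ, ∀ n < N, a n = 0

/-- `f` is meromorphic at the cusp `α∞`. -/
def MeromAtCusp (k : ℤ) (f : ℍ → ℂ) (α : SL(2, ℤ)) : Prop :=
  ∃ (h : ℕ+) (a : ℤ → ℂ), CoeffsBddBelow a ∧ HasExpansion h (f ∣[k] α) a

/-- `f` is holomorphic at the cusp `α∞`. -/
def HoloAtCusp (k : ℤ) (f : ℍ → ℂ) (α : SL(2, ℤ)) : Prop :=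
  ∃ (h : ℕ+) (a : ℤ → ℂ), (∀ n < 0, a n = 0) ∧ HasExpansion h (f ∣[k] α) a

/-- `f` vanishes at the cusp `α∞`. -/
def VanishesAtCusp (k : ℤ) (f : ℍ → ℂ) (α : SL(2, ℤ)) : Prop :=
  ∃ (h : ℕ+) (a : ℤ → ℂ), (∀ n ≤ 0, a n = 0) ∧ HasExpansion h (f ∣[k] α) a

/-- `f` is a weakly holomorphic modular form of weight `k` for `Γ₀(N)`. -/
def IsWeaklyHol (N : ℕ) (k : ℤ) (f : ℍ → ℂ) : Prop :=
  MDifferentiable 𝓘(ℂ) 𝓘(ℂ) f ∧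
  (∀ γ : Gamma0 N, f ∣[k] (γ : SL(2, ℤ)) = f) ∧
  ∀ α : SL(2, ℤ), MeromAtCusp k f α

/-- The translation matrix `T = (1 1; 0 1)`. -/
def T : SL(2, ℤ) := ⟨!![1, 1; 0, 1], by norm_num [Matrix.det_fin_two_of]⟩

/-- `S = (0 -1; 1 0)`. -/
def S : SL(2, ℤ) := ⟨!![0, -1; 1, 0], by norm_num [Matrix.det_fin_two_of]⟩

/-- `Sj j = (0 -1; 1 j)`. -/
def Sj (j : ℤ) : SL(2, ℤ) := ⟨!![0, -1; 1, j], by norm_num [Matrix.det_fin_two_of]⟩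

/-- `L c = (1 0; c 1)`. -/
def L (c : ℤ) : SL(2, ℤ) := ⟨!![1, 0; c, 1], by norm_num [Matrix.det_fin_two_of]⟩

/-- `α` maps the cusp `∞` to a cusp `Γ₀(N)`-equivalent to `∞`. -/
def SendsInfToInf (N : ℕ) (α : SL(2, ℤ)) : Prop :=
  ∃ γ ∈ Gamma0 N, ∃ n : ℤ, α = γ * T ^ n

/-- `f` is a weakly holomorphic modular form of weight `k` for `Γ₀(N)` whose only possible
pole is at the cusp `∞`. -/
def PolesOnlyAtInf (N : ℕ) (k : ℤ) (f : ℍ → ℂ) : Prop :=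
  IsWeaklyHol N k f ∧ ∀ α : SL(2, ℤ), ¬ SendsInfToInf N α → HoloAtCusp k f α

/-- `s` is a complete set of right coset representatives for `Γ₀(N)` in `Γ₀(M)`. -/
def IsCosetReps (N M : ℕ) (s : Finset SL(2, ℤ)) : Prop :=
  (∀ γ ∈ s, γ ∈ Gamma0 M) ∧ ∀ δ ∈ Gamma0 M, ∃! γ, γ ∈ s ∧ δ * γ⁻¹ ∈ Gamma0 N

/-- An element of `GL(2, ℝ)⁺` from a matrix with positive determinant. -/
def glPos (M : Matrix (Fin 2) (Fin 2) ℝ) (h : 0 < M.det) : GL(2, ℝ)⁺ :=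
  ⟨Matrix.GeneralLinearGroup.mkOfDetNeZero M (ne_of_gt h), by
    simpa [Matrix.mem_glpos, Matrix.GeneralLinearGroup.mkOfDetNeZero] using h⟩

end Grid

open Grid

namespace EtaAux

open Topology Asymptotics

/-- The Euler product `∏ (1 - q^(n+1))`. -/
def P (q : ℂ) : ℂ := ∏' n : ℕ, (1 - q ^ (n + 1))

lemma P_diff : DifferentiableOn ℂ P (Metric.ball 0 1) :=
  ModularForm.differentiableOn_tprod_one_sub_pow

lemma P_zero : P 0 = 1 := by simp [P]

lemma P_ne_zero {q : ℂ} (hq : ‖q‖ < 1) : P q ≠ 0 := by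
  have := tprod_one_add_ne_zero_of_summable (f := fun n : ℕ ↦ -q ^ (n + 1)) ?_ ?_
  · simpa [P, sub_eq_add_neg] using this
  · intro n h
    have h1 : q ^ (n + 1) = 1 := by linear_combination -h
    have h2 : ‖q‖ ^ (n + 1) = 1 := by rw [← norm_pow, h1, norm_one]
    have h3 : ‖q‖ ^ (n + 1) < 1 := pow_lt_one₀ (norm_nonneg _) hq (by omega)
    linarith
  · simpa using (summable_nat_add_iff 1).mpr (summable_geometric_of_lt_one (norm_nonneg _) hq)

lemma tail_bound {q : ℂ} (hq : ‖q‖ ≤ 1 / 2) :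
    ‖(∏' n : ℕ, (1 - q ^ (n + 3 + 1))) - 1‖ ≤ 4 * ‖q‖ ^ 4 := by
  have hq1 : ‖q‖ < 1 := by linarith
  have hm : Multipliable fun n : ℕ ↦ 1 - q ^ (n + 3 + 1) := by
    apply multipliable_one_add_of_summable (f := fun n : ℕ ↦ -q ^ (n + 3 + 1))
    simpa [add_assoc] using
      (summable_nat_add_iff 4).mpr (summable_geometric_of_lt_one (norm_nonneg _) hq1)
  have ht := hm.hasProd.sub_const (1 : ℂ)
  have hx : ‖q‖ ^ 4 ≤ 1 / 16 := by
    calc ‖q‖ ^ 4 ≤ (1 / 2) ^ 4 := pow_le_pow_left₀ (norm_nonneg _) hq 4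
      _ = 1 / 16 := by norm_num
  refine le_of_tendsto ht.norm (Filter.Eventually.of_forall fun s ↦ ?_)
  have h1 := s.norm_prod_one_add_sub_one_le (fun n : ℕ ↦ -q ^ (n + 3 + 1))
  have h2 : ∑ i ∈ s, ‖-q ^ (i + 3 + 1)‖ ≤ 2 * ‖q‖ ^ 4 := by
    have hs : Summable fun n : ℕ ↦ ‖q‖ ^ 4 * ‖q‖ ^ n :=
      (summable_geometric_of_lt_one (norm_nonneg _) hq1).mul_left _
    have h3 := hs.sum_le_tsum s (fun i _ ↦ by positivity)
    rw [tsum_mul_left, tsum_geometric_of_lt_one (norm_nonneg _) hq1] at h3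
    have h4 : ∑ i ∈ s, ‖-q ^ (i + 3 + 1)‖ = ∑ i ∈ s, ‖q‖ ^ 4 * ‖q‖ ^ i := by
      apply Finset.sum_congr rfl; intro i _; rw [norm_neg, norm_pow]; ring
    have h5 : (1 - ‖q‖)⁻¹ ≤ 2 := by
      rw [inv_le_comm₀ (by linarith) (by norm_num)]; linarith
    rw [h4]
    nlinarith [norm_nonneg q, pow_nonneg (norm_nonneg q) 4]
  have h6 := Real.abs_exp_sub_one_le (x := 2 * ‖q‖ ^ 4)
    (by rw [abs_of_nonneg (by positivity)]; linarith)
  rw [abs_of_nonneg (by positivity : (0 : ℝ) ≤ 2 * ‖q‖ ^ 4)] at h6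
  have h7 := le_abs_self (Real.exp (2 * ‖q‖ ^ 4) - 1)
  have h8 := Real.exp_le_exp.mpr h2
  simp only [← sub_eq_add_neg] at h1
  linarith

lemma tail_bigO : (fun q : ℂ ↦ (∏' n : ℕ, (1 - q ^ (n + 3 + 1))) - 1) =O[𝓝 0]
    fun q : ℂ ↦ q ^ 4 := by
  refine .of_bound 4 ?_
  filter_upwards [Metric.closedBall_mem_nhds (0 : ℂ) (by norm_num : (0 : ℝ) < 1 / 2)] with q hq
  rw [norm_pow]
  exact tail_bound (by simpa using hq)

lemma P_eq {q : ℂ} (hq : ‖q‖ < 1) :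
    P q = (1 - q) * (1 - q ^ 2) * (1 - q ^ 3) * ∏' n : ℕ, (1 - q ^ (n + 3 + 1)) := by
  have := (Multipliable.prod_mul_tprod_nat_mul' (f := fun n : ℕ ↦ 1 - q ^ (n + 1)) (k := 3) ?_)
  · rw [P, ← this]; simp [Finset.prod_range_succ]
  · apply multipliable_one_add_of_summable (f := fun n : ℕ ↦ -q ^ (n + 3 + 1))
    simpa [add_assoc] using
      (summable_nat_add_iff 4).mpr (summable_geometric_of_lt_one (norm_nonneg _) hq)

lemma bigO_one_of_cont {f : ℂ → ℂ} (hf : ContinuousAt f 0) : f =O[𝓝 0] fun _ : ℂ ↦ (1 : ℂ) :=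
  hf.tendsto.isBigO_one ℂ

lemma ball_nhds : Metric.ball (0 : ℂ) 1 ∈ 𝓝 (0 : ℂ) := Metric.ball_mem_nhds _ one_pos

lemma P_cont : ContinuousAt P 0 := (P_diff.differentiableAt ball_nhds).continuousAt

lemma P_bigO : (fun q : ℂ ↦ P q - (1 - q - q ^ 2)) =O[𝓝 0] fun q : ℂ ↦ q ^ 4 := by
  have h1 : (fun q : ℂ ↦ (1 - q) * (1 - q ^ 2) * (1 - q ^ 3) *
      ((∏' n : ℕ, (1 - q ^ (n + 3 + 1))) - 1)) =O[𝓝 0] fun q : ℂ ↦ q ^ 4 := by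
    simpa using (bigO_one_of_cont (f := fun q : ℂ ↦ (1 - q) * (1 - q ^ 2) * (1 - q ^ 3))
      (by fun_prop)).mul tail_bigO
  have h2 : (fun q : ℂ ↦ (1 + q - q ^ 2) * q ^ 4) =O[𝓝 0] fun q : ℂ ↦ q ^ 4 := by
    simpa using (bigO_one_of_cont (f := fun q : ℂ ↦ 1 + q - q ^ 2)
      (by fun_prop)).mul (isBigO_refl (fun q : ℂ ↦ q ^ 4) _)
  refine (h1.add h2).congr' ?_ .rfl
  filter_upwards [ball_nhds] with q hq
  rw [P_eq (by simpa using hq)]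
  ring

lemma P5_bigO : (fun q : ℂ ↦ P (q ^ 5) - 1) =O[𝓝 0] fun q : ℂ ↦ q ^ 4 := by
  have h0 : Tendsto (fun q : ℂ ↦ q ^ 5) (𝓝 0) (𝓝 0) := by
    simpa using (continuous_pow (M := ℂ) 5).tendsto 0
  have h1 := (P_diff.differentiableAt ball_nhds).isBigO_sub
  simp only [P_zero, sub_zero] at h1
  refine (h1.comp_tendsto h0).trans ?_
  have h2 := (bigO_one_of_cont (f := fun q : ℂ ↦ q)
      (by fun_prop)).mul (isBigO_refl (fun q : ℂ ↦ q ^ 4) (𝓝 0))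
  refine h2.congr (fun q ↦ ?_) (fun q ↦ by simp)
  simp; ring

/-- `G(q) = ∏ (1 - q^(5n))^10 / ∏ (1 - q^n)^2`. -/
def G (q : ℂ) : ℂ := P (q ^ 5) ^ 10 / P q ^ 2

lemma pow5_mem {q : ℂ} (hq : q ∈ Metric.ball (0 : ℂ) 1) : q ^ 5 ∈ Metric.ball (0 : ℂ) 1 := by
  simp only [Metric.mem_ball, dist_zero_right, norm_pow] at hq ⊢
  exact pow_lt_one₀ (norm_nonneg _) hq (by norm_num)

lemma P5_diff : DifferentiableOn ℂ (fun q ↦ P (q ^ 5)) (Metric.ball 0 1) :=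
  P_diff.comp (by fun_prop) fun _ hq ↦ pow5_mem hq

lemma G_diff : DifferentiableOn ℂ G (Metric.ball 0 1) := by
  refine (P5_diff.pow 10).div (P_diff.pow 2) fun q hq ↦ ?_
  exact pow_ne_zero _ (P_ne_zero (by simpa using hq))

lemma G_cont : ContinuousAt G 0 := (G_diff.differentiableAt ball_nhds).continuousAt

lemma G_bigO : (fun q : ℂ ↦ G q - (1 + 2 * q + 5 * q ^ 2 + 10 * q ^ 3)) =O[𝓝 0]
    fun q : ℂ ↦ q ^ 4 := by
  have hc5 : ContinuousAt (fun q ↦ P (q ^ 5)) 0 :=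
    (P5_diff.differentiableAt ball_nhds).continuousAt
  have hinv : (fun q ↦ (P q ^ 2)⁻¹) =O[𝓝 0] fun _ : ℂ ↦ (1 : ℂ) :=
    bigO_one_of_cont ((P_cont.pow 2).inv₀ (by simp [P_zero]))
  have h1 : (fun q : ℂ ↦ (∑ i ∈ Finset.range 10, P (q ^ 5) ^ i) * (P (q ^ 5) - 1))
      =O[𝓝 0] fun q : ℂ ↦ q ^ 4 := by
    simpa using (bigO_one_of_cont (f := fun q ↦ ∑ i ∈ Finset.range 10, P (q ^ 5) ^ i)
      (tendsto_finsetSum _ fun i _ ↦ hc5.pow i)).mul P5_bigO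
  have h2 : (fun q : ℂ ↦ ((1 + 2 * q + 5 * q ^ 2 + 10 * q ^ 3) * (P q + (1 - q - q ^ 2))) *
      (P q - (1 - q - q ^ 2))) =O[𝓝 0] fun q : ℂ ↦ q ^ 4 := by
    simpa using (bigO_one_of_cont (f := fun q : ℂ ↦
      ((1 + 2 * q + 5 * q ^ 2 + 10 * q ^ 3) * (P q + (1 - q - q ^ 2))))
      (by have := P_cont; fun_prop)).mul P_bigO
  have h3 : (fun q : ℂ ↦ (20 - 2 * q - 25 * q ^ 2 - 10 * q ^ 3) * q ^ 4) =O[𝓝 0]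
      fun q : ℂ ↦ q ^ 4 := by
    simpa using (bigO_one_of_cont (f := fun q : ℂ ↦ 20 - 2 * q - 25 * q ^ 2 - 10 * q ^ 3)
      (by fun_prop)).mul (isBigO_refl (fun q : ℂ ↦ q ^ 4) _)
  have h4 := hinv.mul ((h1.sub h2).add h3)
  refine h4.congr' ?_ (by simp)
  filter_upwards [ball_nhds] with q hq
  have hP := P_ne_zero (q := q) (by simpa using hq)
  rw [geom_sum_mul, G]
  field_simp
  ring

lemma G_expansion : ∃ g : ℕ → ℂ, g 0 = 1 ∧ g 1 = 2 ∧ g 2 = 5 ∧ g 3 = 10 ∧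
    ∀ q : ℂ, ‖q‖ < 1 → HasSum (fun n ↦ g n * q ^ n) (G q) := by
  set K0 : ℂ → ℂ := fun q ↦ (G q - (1 + 2 * q + 5 * q ^ 2 + 10 * q ^ 3)) / q ^ 4 with hK0
  have hd : DifferentiableOn ℂ K0 (Metric.ball 0 1 \ {0}) := by
    refine ((G_diff.mono Set.sdiff_subset).sub (by fun_prop)).div (by fun_prop) fun q hq ↦ ?_
    exact pow_ne_zero _ (by simpa using hq.2)
  have hb : K0 =O[𝓝 0] fun _ : ℂ ↦ (1 : ℂ) := by
    obtain ⟨C, hC0, hC⟩ := G_bigO.exists_nonneg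
    replace hC := hC.bound
    refine .of_bound C ?_
    filter_upwards [hC] with q hq
    by_cases h : q = 0
    · subst h
      simpa [hK0] using hC0
    · rw [hK0]
      simp only [norm_div, norm_one, mul_one]
      rwa [div_le_iff₀ (norm_pos_iff.mpr (pow_ne_zero 4 h))]
  have ho : (fun z => K0 z - K0 0) =o[𝓝[≠] 0] fun z => (z - (0 : ℂ))⁻¹ := by
    have h0 : K0 0 = 0 := by simp [hK0]
    simp only [h0, sub_zero]
    refine (hb.mono nhdsWithin_le_nhds).trans_isLittleO ?_
    rw [isLittleO_iff_tendsto']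
    · exact Tendsto.congr (fun x ↦ by rw [← one_div, one_div_one_div]) nhdsWithin_le_nhds
    · filter_upwards [self_mem_nhdsWithin] with x hx h
      simp at hx h; exact absurd h hx
  have hK := Complex.differentiableOn_update_limUnder_of_isLittleO ball_nhds hd ho
  set K := Function.update K0 0 (limUnder (𝓝[≠] 0) K0) with hKdef
  have hGK : ∀ q : ℂ, G q = 1 + 2 * q + 5 * q ^ 2 + 10 * q ^ 3 + q ^ 4 * K q := by
    intro q
    by_cases h : q = 0
    · subst h; simp [G, P_zero]
    · rw [hKdef, Function.update_of_ne h, hK0]; field_simp; ring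
  let k : ℕ → ℂ := fun n ↦ (Nat.factorial n : ℂ)⁻¹ * iteratedDeriv n K 0
  refine ⟨fun n ↦ match n with | 0 => 1 | 1 => 2 | 2 => 5 | 3 => 10 | (m + 4) => k m,
    rfl, rfl, rfl, rfl, fun q hq ↦ ?_⟩
  have hs := Complex.hasSum_taylorSeries_on_ball hK (z := q) (by simpa using hq)
  rw [← hasSum_nat_add_iff' 4, hGK q]
  convert hs.mul_left (q ^ 4) using 1
  · rfl
  · funext n
    simp only [k, sub_zero, smul_eq_mul]
    ring
  · simp [Finset.sum_range_succ]

end EtaAux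
namespace EtaAux

lemma eta_eq (z : ℂ) : Grid.eta z = ModularForm.eta z := by
  unfold Grid.eta ModularForm.eta Grid.qc
  congr 1
  · simp only [Function.Periodic.qParam]; congr 1; push_cast; ring
  · rw [tprod_pnat_eq_tprod_succ (f := fun n : ℕ ↦ 1 - cexp (2 * ↑Real.pi * Complex.I * z) ^ n)]
    simp only [ModularForm.eta_q_eq_pow]

lemma eta_eq_P (z : ℂ) : Grid.eta z = cexp (↑Real.pi * Complex.I * z / 12) * P (qc z) := by
  unfold Grid.eta P
  rw [tprod_pnat_eq_tprod_succ (f := fun n : ℕ ↦ 1 - qc z ^ n)]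

lemma qc_norm {z : ℂ} (hz : 0 < z.im) : ‖qc z‖ < 1 :=
  UpperHalfPlane.norm_exp_two_pi_I_lt_one ⟨z, hz⟩

lemma eta_ne {z : ℂ} (hz : 0 < z.im) : Grid.eta z ≠ 0 := by
  rw [eta_eq]; exact ModularForm.eta_ne_zero hz

/-- The square of eta on the upper half plane. -/
def E (z : ℍ) : ℂ := Grid.eta z ^ 2

lemma E_ne (z : ℍ) : E z ≠ 0 := pow_ne_zero _ (eta_ne z.im_pos)

lemma eta_T (z : ℂ) : Grid.eta (z + 1) = cexp (↑Real.pi * Complex.I / 12) * Grid.eta z := by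
  have h : qc (z + 1) = qc z := by
    unfold qc
    rw [mul_add, Complex.exp_add, mul_one, Complex.exp_two_pi_mul_I, mul_one]
  rw [eta_eq_P, eta_eq_P, h, ← mul_assoc, ← Complex.exp_add]
  congr 2; ring

lemma csqrt_sq (z : ℂ) : Complex.sqrt z ^ 2 = z := by
  unfold Complex.sqrt
  exact_mod_cast Complex.cpow_nat_inv_pow z two_ne_zero

lemma eta_S (z : ℍ) : Grid.eta (-1 / (z : ℂ)) ^ 2 = (Complex.I)⁻¹ * (z : ℂ) * Grid.eta z ^ 2 := by
  have h : ModularForm.eta (-1 / (z : ℂ)) =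
      (Complex.sqrt Complex.I)⁻¹ * (Complex.sqrt z * ModularForm.eta z) := by
    simpa using ModularForm.eta_comp_eq_csqrt_I_inv z.2
  rw [eta_eq, eta_eq, h]
  rw [mul_pow, mul_pow, _root_.inv_pow, csqrt_sq, csqrt_sq]
  ring

lemma E_slash_S : E ∣[(1 : ℤ)] ModularGroup.S = (Complex.I)⁻¹ • E := by
  ext z
  have h := eta_S z
  rw [SL_slash_apply, modular_S_smul]
  have hz := z.ne_zero
  simp only [E, ModularGroup.denom_S, Pi.smul_apply, smul_eq_mul]
  rw [show (-(z : ℂ))⁻¹ = -1 / (z : ℂ) by field_simp, h]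
  simp only [_root_.zpow_neg, _root_.zpow_one]
  field_simp

lemma E_slash_T : E ∣[(1 : ℤ)] ModularGroup.T = (cexp (↑Real.pi * Complex.I / 12) ^ 2) • E := by
  ext z
  rw [SL_slash_apply, modular_T_smul]
  have h := eta_T z
  simp only [E, Pi.smul_apply, smul_eq_mul, coe_vadd, ModularGroup.denom_apply]
  rw [add_comm] at h
  simp [ModularGroup.T, h, mul_pow]

lemma E_slash (γ : SL(2, ℤ)) : ∃ c : ℂ, c ≠ 0 ∧ E ∣[(1 : ℤ)] γ = c • E := by
  have : γ ∈ Subgroup.closure {ModularGroup.S, ModularGroup.T} := by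
    simp [SpecialLinearGroup.SL2Z_generators]
  induction this using Subgroup.closure_induction with
  | one => exact ⟨1, one_ne_zero, by simp⟩
  | mem g hg =>
    rcases hg with rfl | rfl
    · exact ⟨_, inv_ne_zero Complex.I_ne_zero, E_slash_S⟩
    · exact ⟨_, pow_ne_zero _ (Complex.exp_ne_zero _), E_slash_T⟩
  | mul g h _ _ hg hh =>
    obtain ⟨c, hc, hg⟩ := hg
    obtain ⟨d, hd, hh⟩ := hh
    exact ⟨c * d, mul_ne_zero hc hd, by
      rw [SlashAction.slash_mul, hg, SL_smul_slash, hh, smul_smul]⟩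
  | inv g _ hg =>
    obtain ⟨c, hc, hg⟩ := hg
    refine ⟨c⁻¹, inv_ne_zero hc, ?_⟩
    have h1 : (E ∣[(1 : ℤ)] g) ∣[(1 : ℤ)] g⁻¹ = E := by
      rw [← SlashAction.slash_mul, mul_inv_cancel, SlashAction.slash_one]
    rw [hg, SL_smul_slash] at h1
    rw [← h1, smul_smul, inv_mul_cancel₀ hc, one_smul, h1]

lemma E_apply (γ : SL(2, ℤ)) : ∃ c : ℂ, c ≠ 0 ∧ ∀ z : ℍ,
    E (γ • z) = c * (((γ 1 0 : ℤ) : ℂ) * z + ((γ 1 1 : ℤ) : ℂ)) * E z := by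
  obtain ⟨c, hc, h⟩ := E_slash γ
  refine ⟨c, hc, fun z ↦ ?_⟩
  have h1 := congrFun h z
  have h2 : denom γ z ≠ 0 := denom_ne_zero _ _
  rw [SL_slash_apply] at h1
  rw [ModularGroup.denom_apply] at h1 h2
  simp only [_root_.zpow_neg, _root_.zpow_one, Pi.smul_apply, smul_eq_mul] at h1
  rw [mul_inv_eq_iff_eq_mul₀ h2] at h1
  rw [h1]; ring

/-- `5z` in the upper half plane. -/
def five (z : ℍ) : ℍ := ⟨5 * (z : ℂ), by simpa using z.im_pos⟩

lemma five_coe (z : ℍ) : ((five z : ℍ) : ℂ) = 5 * (z : ℂ) := rfl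

/-- The eta quotient. -/
def f (z : ℍ) : ℂ := Grid.eta (5 * (z : ℂ)) ^ 10 / Grid.eta (z : ℂ) ^ 2

lemma f_eq (z : ℍ) : f z = E (five z) ^ 5 / E z := by
  simp only [f, E, five_coe]; ring

lemma f_ne (z : ℍ) : f z ≠ 0 := by
  rw [f_eq]; exact div_ne_zero (pow_ne_zero _ (E_ne _)) (E_ne _)

lemma mem5 {γ : SL(2, ℤ)} : γ ∈ Gamma0 5 ↔ (5 : ℤ) ∣ γ 1 0 := by
  rw [Gamma0_mem]; exact ZMod.intCast_zmod_eq_zero_iff_dvd _ 5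

lemma f_apply {γ : SL(2, ℤ)} (hγ : γ ∈ Gamma0 5) : ∃ c : ℂ, c ≠ 0 ∧ ∀ z : ℍ,
    f (γ • z) = c * (((γ 1 0 : ℤ) : ℂ) * z + ((γ 1 1 : ℤ) : ℂ)) ^ 4 * f z := by
  obtain ⟨m, hm⟩ := mem5.mp hγ
  have hdet := γ.det_coe
  rw [Matrix.det_fin_two] at hdet
  let γ' : SL(2, ℤ) := ⟨!![γ 0 0, 5 * γ 0 1; m, γ 1 1], by
    rw [Matrix.det_fin_two_of]; rw [hm] at hdet; linarith⟩
  have hfive : ∀ z : ℍ, five (γ • z) = γ' • five z := by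
    intro z
    ext1
    rw [five_coe, coe_specialLinearGroup_apply, coe_specialLinearGroup_apply, five_coe, hm]
    simp [γ']
    ring
  obtain ⟨c, hc, h⟩ := E_apply γ
  obtain ⟨d, hd, h'⟩ := E_apply γ'
  refine ⟨d ^ 5 / c, by positivity, fun z ↦ ?_⟩
  have hden : (((γ 1 0 : ℤ) : ℂ) * z + ((γ 1 1 : ℤ) : ℂ)) ≠ 0 := by
    rw [← ModularGroup.denom_apply]; exact denom_ne_zero _ _
  have hE := E_ne z
  rw [f_eq, f_eq, hfive, h, h', five_coe]
  have : (((γ' 1 0 : ℤ) : ℂ) * (5 * (z : ℂ)) + ((γ' 1 1 : ℤ) : ℂ)) =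
      (((γ 1 0 : ℤ) : ℂ) * z + ((γ 1 1 : ℤ) : ℂ)) := by
    rw [hm]; simp [γ']; ring
  rw [this]
  field_simp

lemma f_slash_of {γ : SL(2, ℤ)} (h : ∀ z : ℍ,
    f (γ • z) = (((γ 1 0 : ℤ) : ℂ) * z + ((γ 1 1 : ℤ) : ℂ)) ^ 4 * f z) :
    f ∣[(4 : ℤ)] γ = f := by
  ext z
  have hden : (((γ 1 0 : ℤ) : ℂ) * z + ((γ 1 1 : ℤ) : ℂ)) ≠ 0 := by
    rw [← ModularGroup.denom_apply]; exact denom_ne_zero _ _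
  rw [SL_slash_apply, ModularGroup.denom_apply, h, _root_.zpow_neg, zpow_ofNat]
  field_simp

/-- The invariance subgroup. -/
def H : Subgroup SL(2, ℤ) where
  carrier := {γ | f ∣[(4 : ℤ)] γ = f}
  one_mem' := by simp
  mul_mem' := by
    intro a b ha hb
    simp only [Set.mem_ofPred_eq] at *
    rw [SlashAction.slash_mul, ha, hb]
  inv_mem' := by
    intro a ha
    simp only [Set.mem_ofPred_eq] at *
    conv_lhs => rw [← ha]
    rw [← SlashAction.slash_mul, mul_inv_cancel, SlashAction.slash_one]

lemma mem_H {γ : SL(2, ℤ)} : γ ∈ H ↔ f ∣[(4 : ℤ)] γ = f := Iff.rfl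

lemma T_mem : ModularGroup.T ∈ H := by
  refine f_slash_of fun z ↦ ?_
  have h5 : Grid.eta (5 * (z : ℂ) + 5) =
      cexp (↑Real.pi * Complex.I / 12) ^ 5 * Grid.eta (5 * (z : ℂ)) := by
    rw [show 5 * (z : ℂ) + 5 = 5 * (z : ℂ) + 1 + 1 + 1 + 1 + 1 by ring]
    simp only [eta_T]; ring
  have h48 : cexp (↑Real.pi * Complex.I / 12) ^ 48 = 1 := by
    rw [← Complex.exp_nat_mul, Complex.exp_eq_one_iff]
    exact ⟨2, by push_cast; ring⟩
  rw [modular_T_smul]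
  simp only [f, coe_vadd]
  rw [show ((1 : ℝ) : ℂ) + z = z + 1 by push_cast; ring, mul_add, mul_one, h5, eta_T]
  have hx := Complex.exp_ne_zero (↑Real.pi * Complex.I / 12)
  have he := eta_ne z.im_pos
  simp [ModularGroup.T]
  generalize cexp (↑Real.pi * Complex.I / 12) = x at *
  have h0 := eta_ne z.im_pos
  rw [div_eq_div_iff (by positivity) (by positivity)]
  linear_combination (Grid.eta (5 * (z : ℂ)) ^ 10 * x ^ 2 * Grid.eta z ^ 2) * h48

lemma neg_mem : (-1 : SL(2, ℤ)) ∈ H := by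
  refine f_slash_of fun z ↦ ?_
  simp
  norm_num

lemma elliptic {γ : SL(2, ℤ)} (hγ : γ ∈ Gamma0 5) (z : ℍ) (hz : γ • z = z)
    (hi : ((γ 1 0 : ℤ) : ℂ) * z + ((γ 1 1 : ℤ) : ℂ) = Complex.I) : γ ∈ H := by
  obtain ⟨c, hc, h⟩ := f_apply hγ
  have h1 := h z
  rw [hz, hi, Complex.I_pow_four, mul_one] at h1
  have hc1 : c = 1 := by
    have := f_ne z
    field_simp at h1
    exact h1.symm
  subst hc1
  exact f_slash_of (by simpa using h)

def e1 : SL(2, ℤ) := ⟨!![-2, -1; 5, 2], by norm_num [Matrix.det_fin_two_of]⟩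
def e2 : SL(2, ℤ) := ⟨!![2, -1; 5, -2], by norm_num [Matrix.det_fin_two_of]⟩
def L5 : SL(2, ℤ) := ⟨!![1, 0; -5, 1], by norm_num [Matrix.det_fin_two_of]⟩

lemma e1_mem : e1 ∈ H := by
  refine elliptic (mem5.mpr (by simp [e1])) ⟨(-2 + Complex.I) / 5, by simp⟩ ?_ ?_
  · ext1
    rw [coe_specialLinearGroup_apply]
    simp [e1]
    rw [show 5 * ((-2 + Complex.I) / 5) + 2 = Complex.I by ring, div_eq_iff Complex.I_ne_zero]
    linear_combination (-1 / 5 : ℂ) * Complex.I_sq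
  · simp [e1]; ring

lemma e2_mem : e2 ∈ H := by
  refine elliptic (mem5.mpr (by simp [e2])) ⟨(2 + Complex.I) / 5, by simp⟩ ?_ ?_
  · ext1
    rw [coe_specialLinearGroup_apply]
    simp [e2]
    rw [show 5 * ((2 + Complex.I) / 5) + -2 = Complex.I by ring, div_eq_iff Complex.I_ne_zero]
    linear_combination (-1 / 5 : ℂ) * Complex.I_sq
  · simp [e2]; ring

lemma L5_mem : L5 ∈ H := by
  have : L5 = e1 * ModularGroup.T⁻¹ * e2 := by decide
  rw [this]
  exact H.mul_mem (H.mul_mem e1_mem (H.inv_mem T_mem)) e2_mem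

end EtaAux
namespace EtaAux

lemma mulT_10 (γ : SL(2, ℤ)) (n : ℤ) : (γ * ModularGroup.T ^ n) 1 0 = γ 1 0 := by
  rw [Matrix.SpecialLinearGroup.coe_mul, ModularGroup.coe_T_zpow]
  simp [Matrix.mul_apply, Fin.sum_univ_two]

lemma mulT_11 (γ : SL(2, ℤ)) (n : ℤ) :
    (γ * ModularGroup.T ^ n) 1 1 = γ 1 0 * n + γ 1 1 := by
  rw [Matrix.SpecialLinearGroup.coe_mul, ModularGroup.coe_T_zpow]
  simp [Matrix.mul_apply, Fin.sum_univ_two]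

lemma mul_10 (γ M : SL(2, ℤ)) : (γ * M) 1 0 = γ 1 0 * M 0 0 + γ 1 1 * M 1 0 := by
  rw [Matrix.SpecialLinearGroup.coe_mul]
  simp [Matrix.mul_apply, Fin.sum_univ_two]

lemma Tpow_mem (n : ℤ) : ModularGroup.T ^ n ∈ H := H.zpow_mem T_mem n

lemma step_aux (γ : SL(2, ℤ)) (c : ℤ) (hc : γ 1 0 = 5 * c) (h0 : c ≠ 0)
    (hd : 2 * |γ 1 1| ≤ 5 * |c|) :
    ∃ M ∈ H, ∃ c', (γ * M) 1 0 = 5 * c' ∧ |c'| < |c| := by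
  have hdet := γ.det_coe
  rw [Matrix.det_fin_two, hc] at hdet
  have hd0 : γ 1 1 ≠ 0 := by
    intro h
    rw [h] at hdet
    have : (5 : ℤ) ∣ 1 := ⟨- (γ 0 1 * c), by linarith⟩
    omega
  have h1 : (γ * L5) 1 0 = 5 * (c - γ 1 1) := by
    rw [mul_10, hc]; simp [L5]; ring
  have h2 : (γ * L5⁻¹) 1 0 = 5 * (c + γ 1 1) := by
    rw [mul_10, hc, Matrix.SpecialLinearGroup.SL2_inv_expl]; simp [L5]; ring
  have h3 : (γ * e1) 1 0 = 5 * (γ 1 1 - 2 * c) := by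
    rw [mul_10, hc]; simp [e1]; ring
  have h4 : (γ * e2) 1 0 = 5 * (γ 1 1 + 2 * c) := by
    rw [mul_10, hc]; simp [e2]; ring
  generalize γ 1 1 = d at *
  by_cases hs : |c - d| < |c|
  · exact ⟨_, L5_mem, _, h1, hs⟩
  by_cases hs2 : |c + d| < |c|
  · exact ⟨_, H.inv_mem L5_mem, _, h2, hs2⟩
  by_cases hs3 : |d - 2 * c| < |c|
  · exact ⟨_, e1_mem, _, h3, hs3⟩
  refine ⟨_, e2_mem, _, h4, ?_⟩
  simp only [Int.abs_eq_natAbs] at *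
  omega

lemma step (γ : SL(2, ℤ)) (c : ℤ) (hc : γ 1 0 = 5 * c) (h0 : c ≠ 0) :
    ∃ M ∈ H, ∃ c', (γ * M) 1 0 = 5 * c' ∧ |c'| < |c| := by
  have key : ∃ n : ℤ, 2 * |γ 1 0 * n + γ 1 1| ≤ 5 * |c| := by
    rw [hc]
    refine ⟨- round ((γ 1 1 : ℚ) / (5 * c)), ?_⟩
    have h := abs_sub_round ((γ 1 1 : ℚ) / (5 * c))
    generalize round ((γ 1 1 : ℚ) / (5 * c)) = r at *
    have h5 : (0 : ℚ) < |5 * (c : ℚ)| := by positivity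
    have := mul_le_mul_of_nonneg_right h h5.le
    rw [← abs_mul, sub_mul, div_mul_cancel₀ _ (by positivity)] at this
    have h6 : 2 * |5 * (c : ℚ) * (-r) + γ 1 1| ≤ 5 * |(c : ℚ)| := by
      rw [abs_mul, show |(5 : ℚ)| = 5 by norm_num] at this
      rw [show 5 * (c : ℚ) * (-r) + γ 1 1 = γ 1 1 - r * (5 * c) by ring]
      linarith
    exact_mod_cast h6
  obtain ⟨n, hn⟩ := key
  obtain ⟨M, hM, c', h1, h2⟩ := step_aux (γ * ModularGroup.T ^ n) c
    (by rw [mulT_10, hc]) h0 (by rw [mulT_11]; exact hn)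
  exact ⟨ModularGroup.T ^ n * M, H.mul_mem (Tpow_mem n) hM, c', by rw [← mul_assoc, h1], h2⟩

lemma mem_of_zero (γ : SL(2, ℤ)) (hc : γ 1 0 = 0) : γ ∈ H := by
  obtain ⟨n, h | h⟩ : ∃ n : ℤ, γ = ModularGroup.T ^ n ∨ γ = -ModularGroup.T ^ n := by
    have hdet := γ.det_coe
    rw [Matrix.det_fin_two, hc] at hdet
    have hm : γ 0 0 * γ 1 1 = 1 := by linarith
    rcases Int.eq_one_or_neg_one_of_mul_eq_one' hm with ⟨h1, h2⟩ | ⟨h1, h2⟩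
    · refine ⟨γ 0 1, Or.inl ?_⟩
      ext i j
      rw [ModularGroup.coe_T_zpow]
      fin_cases i <;> fin_cases j <;> simp [h1, h2, hc]
    · refine ⟨-γ 0 1, Or.inr ?_⟩
      ext i j
      rw [Matrix.SpecialLinearGroup.coe_neg, ModularGroup.coe_T_zpow]
      fin_cases i <;> fin_cases j <;> simp [h1, h2, hc]
  · rw [h]; exact Tpow_mem n
  · rw [h, ← neg_one_mul]; exact H.mul_mem neg_mem (Tpow_mem n)

lemma gamma_aux (N : ℕ) : ∀ (γ : SL(2, ℤ)) (c : ℤ), γ 1 0 = 5 * c → |c| ≤ N → γ ∈ H := by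
  induction N with
  | zero =>
    intro γ c hc h
    have : c = 0 := by simpa using h
    exact mem_of_zero γ (by rw [hc, this, mul_zero])
  | succ N ih =>
    intro γ c hc h
    by_cases h0 : c = 0
    · exact mem_of_zero γ (by rw [hc, h0, mul_zero])
    obtain ⟨M, hM, c', h1, h2⟩ := step γ c hc h0
    have := ih (γ * M) c' h1 (by push_cast at h; omega)
    exact (H.mul_mem_cancel_right hM).mp this

lemma gamma_le : Gamma0 5 ≤ H := by
  intro γ hγ
  obtain ⟨c, hc⟩ := mem5.mp hγ
  exact gamma_aux c.natAbs γ c hc (by simp)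

/-! Expansion -/

lemma qc_five (z : ℂ) : qc (5 * z) = qc z ^ 5 := by
  unfold qc; rw [← Complex.exp_nat_mul]; congr 1; push_cast; ring

lemma f_G (z : ℍ) : f z = qc z ^ 2 * G (qc z) := by
  unfold f G
  rw [eta_eq_P, eta_eq_P, qc_five]
  have h : cexp (↑Real.pi * Complex.I * (5 * z) / 12) ^ 10 =
      qc z ^ 2 * cexp (↑Real.pi * Complex.I * z / 12) ^ 2 := by
    unfold qc
    rw [← Complex.exp_nat_mul, ← Complex.exp_nat_mul, ← Complex.exp_nat_mul, ← Complex.exp_add]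
    congr 1; push_cast; ring
  have h1 := Complex.exp_ne_zero (↑Real.pi * Complex.I * z / 12)
  have h2 := P_ne_zero (qc_norm z.im_pos)
  rw [mul_pow, h, mul_pow]
  field_simp

lemma f_expansion : ∃ a : ℤ → ℂ, HasExpansion 1 f a ∧ (∀ n < (2 : ℤ), a n = 0) ∧
        a 2 = 1 ∧ a 3 = 2 ∧ a 4 = 5 ∧ a 5 = 10 := by
  obtain ⟨g, h0, h1, h2, h3, hg⟩ := G_expansion
  refine ⟨fun n ↦ if n < 2 then 0 else g (n - 2).toNat, ?_, ?_, ?_, ?_, ?_, ?_⟩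
  · intro z
    have hs := (hg (qc z) (qc_norm z.im_pos)).mul_left (qc z ^ 2)
    rw [← f_G] at hs
    have hinj : Function.Injective (fun n : ℕ ↦ (n : ℤ) + 2) := by
      intro a b h
      simpa using h
    symm
    refine HasSum.tsum_eq ?_
    rw [← hinj.hasSum_iff]
    · convert hs using 1
      · rfl
      funext n
      have e : cexp (2 * ↑Real.pi * Complex.I * ((n : ℂ) + 2) * z) = qc z ^ (n + 2) := by
        unfold qc; rw [← Complex.exp_nat_mul]; congr 1; push_cast; ring
      simp only [Function.comp]
      rw [if_neg (by omega)]
      simp [e]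
      ring
    · intro n hn
      have : n < 2 := by
        by_contra hh
        exact hn ⟨(n - 2).toNat, by simp; omega⟩
      simp [this]
  · intro n hn; simp [hn]
  all_goals norm_num
  · exact h0
  · exact h1
  · exact h2
  · exact h3

/-! Holomorphy and cusps -/

lemma f_mdiff : MDifferentiable 𝓘(ℂ) 𝓘(ℂ) f := by
  rw [UpperHalfPlane.mdifferentiable_iff]
  have key : DifferentiableOn ℂ (fun z : ℂ ↦ Grid.eta (5 * z) ^ 10 / Grid.eta z ^ 2)
      {z | 0 < z.im} := by
    intro z hz
    have hz' : 0 < z.im := hz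
    have h5 : 0 < (5 * z).im := by simpa using hz'
    have he : Grid.eta = ModularForm.eta := funext eta_eq
    have d1 : DifferentiableAt ℂ Grid.eta z := by
      rw [he]; exact ModularForm.differentiableAt_eta_of_mem_upperHalfPlaneSet hz'
    have d5 : DifferentiableAt ℂ Grid.eta (5 * z) := by
      rw [he]; exact ModularForm.differentiableAt_eta_of_mem_upperHalfPlaneSet h5
    have d5' : DifferentiableAt ℂ (fun z ↦ Grid.eta (5 * z)) z :=
      d5.comp z (by fun_prop)
    exact ((d5'.pow 10).div (d1.pow 2) (pow_ne_zero _ (eta_ne hz'))).differentiableWithinAt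
  refine key.congr fun z hz ↦ ?_
  have hz' : 0 < z.im := hz
  simp [f, ofComplex_apply_of_im_pos hz']

lemma qc_tendsto (h : ℝ) (hh : 0 < h) :
    Tendsto (fun z : ℍ ↦ qc ((z : ℂ) / h)) atImInfty (nhds 0) := by
  have := UpperHalfPlane.qParam_tendsto_atImInfty hh
  refine this.congr fun z ↦ ?_
  unfold qc Function.Periodic.qParam
  congr 1; ring

lemma f_bdd : IsBoundedAtImInfty f := by
  have h1 : Tendsto (fun z : ℍ ↦ qc (z : ℂ)) atImInfty (nhds 0) := by
    simpa using qc_tendsto 1 one_pos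
  have h2 := (h1.pow 2).mul (G_cont.tendsto.comp h1)
  have h3 : Tendsto f atImInfty (nhds (0 ^ 2 * G 0)) := by
    refine h2.congr fun z ↦ ?_
    rw [f_G]; rfl
  exact h3.isBigO_one ℝ

/-- `z/5` in the upper half plane. -/
def fifth (z : ℍ) : ℍ := ⟨(z : ℂ) / 5, by simpa using z.im_pos⟩

lemma fS (z : ℍ) : (f ∣[(4 : ℤ)] ModularGroup.S) z =
    (1 / 5) ^ 5 * (P (qc ((z : ℂ) / 5)) ^ 10 / P (qc ((z : ℂ) / 5) ^ 5) ^ 2) := by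
  rw [SL_slash_apply, modular_S_smul, ModularGroup.denom_S]
  have hz := z.ne_zero
  have hs := eta_S z
  have hs5 := eta_S (fifth z)
  have hc : ((fifth z : ℍ) : ℂ) = (z : ℂ) / 5 := rfl
  rw [hc] at hs5
  simp only [f]
  rw [show (-(z : ℂ))⁻¹ = -1 / (z : ℂ) by field_simp,
    show 5 * (-1 / (z : ℂ)) = -1 / ((z : ℂ) / 5) by field_simp,
    show Grid.eta (-1 / ((z : ℂ) / 5)) ^ 10 = (Grid.eta (-1 / ((z : ℂ) / 5)) ^ 2) ^ 5 by ring,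
    hs, hs5, eta_eq_P, eta_eq_P z, ← qc_five, show 5 * ((z : ℂ) / 5) = z by ring]
  have h : cexp (↑Real.pi * Complex.I * (z / 5) / 12) ^ 10 =
      cexp (↑Real.pi * Complex.I * z / 12) ^ 2 := by
    rw [← Complex.exp_nat_mul, ← Complex.exp_nat_mul]
    congr 1; push_cast; ring
  have h1 := Complex.exp_ne_zero (↑Real.pi * Complex.I * z / 12)
  have h2 := P_ne_zero (qc_norm z.im_pos)
  rw [show ((Complex.I)⁻¹ * ((z : ℂ) / 5) *
      (cexp (↑Real.pi * Complex.I * (z / 5) / 12) * P (qc (z / 5))) ^ 2) ^ 5 =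
      (Complex.I⁻¹) ^ 5 * ((z : ℂ) / 5) ^ 5 *
      (cexp (↑Real.pi * Complex.I * (z / 5) / 12) ^ 10 * P (qc (z / 5)) ^ 10) by ring, h]
  have hI := Complex.I_ne_zero
  have hI4 := Complex.I_pow_four
  rw [_root_.zpow_neg, zpow_ofNat]
  field_simp
  rw [hI4]
  try ring

lemma fS_bdd : IsBoundedAtImInfty (f ∣[(4 : ℤ)] ModularGroup.S) := by
  have h1 : Tendsto (fun z : ℍ ↦ qc ((z : ℂ) / 5)) atImInfty (nhds 0) := by
    simpa using qc_tendsto 5 (by norm_num)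
  have hP : ContinuousAt (fun q : ℂ ↦ (1 / 5 : ℂ) ^ 5 * (P q ^ 10 / P (q ^ 5) ^ 2)) 0 := by
    have h5 : ContinuousAt (fun q ↦ P (q ^ 5)) 0 := (P5_diff.differentiableAt ball_nhds).continuousAt
    refine continuousAt_const.mul ((P_cont.pow 10).div (h5.pow 2) ?_)
    simp [P_zero]
  have h3 := hP.tendsto.comp h1
  refine Tendsto.isBigO_one ℝ (h3.congr fun z ↦ ?_)
  rw [fS]; rfl

lemma slash_bdd (γ : SL(2, ℤ)) : IsBoundedAtImInfty (f ∣[(4 : ℤ)] γ) := by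
  by_cases h5 : (5 : ℤ) ∣ γ 1 0
  · rw [mem_H.mp (gamma_le (mem5.mpr h5))]; exact f_bdd
  obtain ⟨j, hj⟩ : ∃ j : ℤ, (5 : ℤ) ∣ γ 1 1 - j * γ 1 0 := by
    have hc : ∀ c d : ℤ, ¬ (5 : ℤ) ∣ c → ∃ j : ℤ, (5 : ℤ) ∣ d - j * c := by
      intro c d h
      refine ⟨d * c ^ 3, ?_⟩
      have h4 : (5 : ℤ) ∣ 1 - c ^ 4 := by
        have : c % 5 = 1 ∨ c % 5 = 2 ∨ c % 5 = 3 ∨ c % 5 = 4 := by omega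
        apply Int.dvd_of_emod_eq_zero
        rcases this with h | h | h | h <;> simp [Int.sub_emod, pow_succ, Int.mul_emod, h]
      rw [show d - d * c ^ 3 * c = d * (1 - c ^ 4) by ring]
      exact h4.mul_left d
    exact hc _ _ h5
  have hmem : γ * ModularGroup.T ^ (-j) * ModularGroup.S⁻¹ ∈ H := by
    apply gamma_le
    rw [mem5, mul_10, mulT_10, mulT_11, Matrix.SpecialLinearGroup.SL2_inv_expl]
    simp [ModularGroup.S]
    rw [show -(γ 1 1 : ℤ) + γ 1 0 * j = -(γ 1 1 - j * γ 1 0) by ring]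
    exact Int.dvd_neg.mpr hj
  have hγ : γ = (γ * ModularGroup.T ^ (-j) * ModularGroup.S⁻¹) * ModularGroup.S *
      ModularGroup.T ^ j := by group
  rw [hγ, SlashAction.slash_mul, SlashAction.slash_mul, mem_H.mp hmem]
  refine IsBoundedAtImInfty.slash _ ?_ fS_bdd
  have h0 : (ModularGroup.T ^ j) 1 0 = 0 := by simp [ModularGroup.coe_T_zpow]
  change (((ModularGroup.T ^ j) 1 0 : ℤ) : ℝ) = 0
  rw [h0, Int.cast_zero]

/-- The modular form. -/
def F : ModularForm (Gamma0 5) 4 where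
  toFun := f
  slash_action_eq' := by
    intro A hA
    obtain ⟨A, hA, rfl⟩ := hA
    exact mem_H.mp (gamma_le hA)
  holo' := f_mdiff
  bdd_at_cusps' := by
    intro c hc
    rw [Subgroup.IsArithmetic.isCusp_iff_isCusp_SL2Z] at hc
    rw [OnePoint.isBoundedAt_iff_forall_SL2Z hc]
    intro γ _
    exact slash_bdd γ

end EtaAux

/-- `η(5z)¹⁰/η(z)²` is a holomorphic modular form of weight 4 for `Γ₀(5)` with `q`-expansion
`q² + 2q³ + 5q⁴ + 10q⁵ + ⋯`, vanishing to order 2 at `∞`. -/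
theorem statement_6 :
    ∃ F : ModularForm (Gamma0 5) 4,
      (∀ z : ℍ, F z = Grid.eta (5 * (z : ℂ)) ^ 10 / Grid.eta (z : ℂ) ^ 2) ∧
      ∃ a : ℤ → ℂ, HasExpansion 1 ⇑F a ∧ (∀ n < (2 : ℤ), a n = 0) ∧
        a 2 = 1 ∧ a 3 = 2 ∧ a 4 = 5 ∧ a 5 = 10 := by
  exact ⟨EtaAux.F, fun z ↦ rfl, EtaAux.f_expansion⟩
end
end

section
/- The eta quotient \psi^{(6)}(z) = \eta(2z)^8\eta(3z)^4/(\eta(z)^4\eta(6z)^8) is a weakly holomorphic modular function for \Gamma_0(6) with a simple pole at \infty and q-expansion q^{-1} + 4 + 6q + 4q^2 - 3q^3 + \cdots, and its values at the three cusps of \Gamma_0(6) other than \infty are exactly the roots of the polynomial x^3 - 10x^2 + 9x, namely 0, 1, and 9. -/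
noncomputable section
open Complex UpperHalfPlane Matrix ModularForm CongruenceSubgroup Filter
open scoped ModularForm MatrixGroups Manifold Real

open Grid

/-- The eta quotient `ψ⁽⁶⁾(z) = η(2z)⁸η(3z)⁴/(η(z)⁴η(6z)⁸)`. -/
def psi6 : ℍ → ℂ := fun z =>
  Grid.eta (2 * (z : ℂ)) ^ 8 * Grid.eta (3 * (z : ℂ)) ^ 4 / (Grid.eta (z : ℂ) ^ 4 * Grid.eta (6 * (z : ℂ)) ^ 8)

namespace Grid

/-- The Euler product. -/
def P (q : ℂ) : ℂ := ∏' n : ℕ, (1 - q ^ (n + 1))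

lemma eta_eq (z : ℂ) : Grid.eta z = ModularForm.eta z := by
  unfold Grid.eta ModularForm.eta
  rw [tprod_pnat_eq_tprod_succ (f := fun n => 1 - qc z ^ n)]
  congr 1
  · unfold Function.Periodic.qParam
    congr 1
    push_cast
    ring
  · simp only [qc, ModularForm.eta_q_eq_pow]

/-- Fourth power of eta. -/
def u (z : ℂ) : ℂ := ModularForm.eta z ^ 4

lemma u_ne_zero {z : ℂ} (hz : 0 < z.im) : u z ≠ 0 :=
  pow_ne_zero _ (ModularForm.eta_ne_zero hz)

lemma eta_P (z : ℂ) : ModularForm.eta z =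
    Complex.exp (2 * π * Complex.I * z / 24) * P (Complex.exp (2 * π * Complex.I * z)) := by
  simp [ModularForm.eta, P, Function.Periodic.qParam, ModularForm.eta_q_eq_pow]

lemma u_P (z : ℂ) : u z =
    Complex.exp (2 * π * Complex.I * z / 6) * P (Complex.exp (2 * π * Complex.I * z)) ^ 4 := by
  rw [u, eta_P, mul_pow, ← Complex.exp_nat_mul]
  congr 2
  push_cast; ring

lemma psi6_u (z : ℍ) : psi6 z = u (2 * z) ^ 2 * u (3 * z) / (u z * u (6 * z) ^ 2) := by
  simp only [psi6, eta_eq, u]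
  ring

/-- The sixth-root-of-unity character. -/
def ch (x : ZMod 6) : ℂ := ZMod.stdAddChar x

lemma ch_add (x y : ZMod 6) : ch (x + y) = ch x * ch y := AddChar.map_add_eq_mul _ _ _
lemma ch_zero : ch 0 = 1 := AddChar.map_zero_eq_one _
lemma ch_ne_zero (x : ZMod 6) : ch x ≠ 0 := by
  intro h
  have := ch_add x (-x)
  rw [h] at this
  simp [ch_zero] at this
lemma ch_one : ch 1 = Complex.exp (2 * π * Complex.I / 6) := by
  have := ZMod.stdAddChar_coe (N := 6) 1
  simpa [ch] using this
lemma ch_three : ch 3 = -1 := by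
  have := ZMod.stdAddChar_coe (N := 6) 3
  have h2 : (2 * π * Complex.I * 3 / 6 : ℂ) = π * Complex.I := by ring
  simp only [Int.cast_ofNat, Nat.cast_ofNat, h2, Complex.exp_pi_mul_I] at this
  exact this

/-- The exponent of the multiplier. -/
def fe (a b c d : ZMod 6) : ZMod 6 :=
  (1 - c ^ 2) * (b * d + 3 * (c - 1) * d + c + 3) + c * (a + d - 3)

set_option maxRecDepth 100000 in
lemma fe_S : ∀ a b c d : ZMod 6, a * d - b * c = 1 → fe (-c) (-d) a b = fe a b c d + 3 := by
  decide +kernel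

set_option maxRecDepth 100000 in
lemma fe_T : ∀ a b c d : ZMod 6, a * d - b * c = 1 → fe (a + c) (b + d) c d = fe a b c d + 1 := by
  decide +kernel

set_option maxRecDepth 100000 in
lemma fe_gamma : ∀ a b c d : ZMod 6, a * d = 1 →
    2 * fe a (2 * b) (3 * c) d + fe a (3 * b) (2 * c) d
      = fe a b 0 d + 2 * fe a (6 * b) c d := by
  decide +kernel

lemma u_T (z : ℂ) : u (z + 1) = ch 1 * u z := by
  rw [u_P, u_P, ch_one]
  have h1 : Complex.exp (2 * π * Complex.I * (z + 1)) = Complex.exp (2 * π * Complex.I * z) := by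
    rw [mul_add, mul_one, Complex.exp_periodic]
  rw [h1, ← mul_assoc, ← Complex.exp_add]
  congr 3
  ring

lemma u_S {z : ℂ} (hz : 0 < z.im) : u (-1 / z) = z ^ 2 * (ch 3 * u z) := by
  have h := ModularForm.eta_comp_eq_csqrt_I_inv hz
  have hz0 : z ≠ 0 := by rintro rfl; simp at hz
  have hs : ∀ w : ℂ, w ≠ 0 → Complex.sqrt w ^ 4 = w ^ 2 := by
    intro w hw
    rw [sqrt_eq_exp hw, ← Complex.exp_nat_mul]
    rw [show ((4 : ℕ) : ℂ) * (Complex.log w / 2) = (2 : ℕ) * Complex.log w by push_cast; ring,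
      Complex.exp_nat_mul, Complex.exp_log hw]
  simp only [Function.comp, Pi.smul_apply, Pi.mul_apply, smul_eq_mul] at h
  rw [u, h, mul_pow, mul_pow, inv_pow, hs _ Complex.I_ne_zero, hs _ hz0, u, ch_three]
  simp

/-- The transformation law for `γ`. -/
def Law (γ : SL(2, ℤ)) : Prop := ∀ z : ℍ, u ((γ • z : ℍ) : ℂ) =
  ((γ 1 0 : ℂ) * z + γ 1 1) ^ 2 *
    (ch (fe (γ 0 0 : ℤ) (γ 0 1 : ℤ) (γ 1 0 : ℤ) (γ 1 1 : ℤ)) * u z)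

lemma den_ne (γ : SL(2, ℤ)) (z : ℍ) : ((γ 1 0 : ℂ) * z + γ 1 1) ≠ 0 := by
  have := UpperHalfPlane.denom_ne_zero γ z
  simpa [UpperHalfPlane.denom] using this

lemma coe_sl (γ : SL(2, ℤ)) (z : ℍ) : ((γ • z : ℍ) : ℂ) =
    ((γ 0 0 : ℂ) * z + γ 0 1) / ((γ 1 0 : ℂ) * z + γ 1 1) := by
  rw [UpperHalfPlane.coe_specialLinearGroup_apply]
  simp

lemma det_z (γ : SL(2, ℤ)) : γ 0 0 * γ 1 1 - γ 0 1 * γ 1 0 = 1 := by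
  have := γ.det_coe
  rwa [Matrix.det_fin_two] at this

lemma det_zmod (γ : SL(2, ℤ)) : ((γ 0 0 : ℤ) : ZMod 6) * (γ 1 1 : ℤ) -
    (γ 0 1 : ℤ) * (γ 1 0 : ℤ) = 1 := by
  exact_mod_cast congrArg (Int.cast : ℤ → ZMod 6) (det_z γ)

lemma S_ent (γ : SL(2, ℤ)) : (ModularGroup.S * γ) 0 0 = - γ 1 0 ∧ (ModularGroup.S * γ) 0 1 = - γ 1 1 ∧
    (ModularGroup.S * γ) 1 0 = γ 0 0 ∧ (ModularGroup.S * γ) 1 1 = γ 0 1 := by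
  simp [Matrix.SpecialLinearGroup.coe_mul, ModularGroup.coe_S, Matrix.mul_apply, Fin.sum_univ_two]

lemma T_ent (γ : SL(2, ℤ)) : (ModularGroup.T * γ) 0 0 = γ 0 0 + γ 1 0 ∧
    (ModularGroup.T * γ) 0 1 = γ 0 1 + γ 1 1 ∧
    (ModularGroup.T * γ) 1 0 = γ 1 0 ∧ (ModularGroup.T * γ) 1 1 = γ 1 1 := by
  simp [Matrix.SpecialLinearGroup.coe_mul, ModularGroup.coe_T, Matrix.mul_apply, Fin.sum_univ_two]

lemma law_S (γ : SL(2, ℤ)) : Law (ModularGroup.S * γ) ↔ Law γ := by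
  unfold Law
  refine forall_congr' fun z => ?_
  obtain ⟨h1, h2, h3, h4⟩ := S_ent γ
  rw [h1, h2, h3, h4, mul_smul, UpperHalfPlane.modular_S_smul]
  have hz := coe_sl γ z
  have hd := den_ne γ z
  have hn : ((γ 0 0 : ℂ) * z + γ 0 1) ≠ 0 := by
    have := den_ne (ModularGroup.S * γ) z
    rwa [h3, h4] at this
  have := u_S (γ • z).im_pos
  push_cast
  rw [show (-((γ • z : ℍ) : ℂ))⁻¹ = -1 / ((γ • z : ℍ) : ℂ) by
    rw [inv_neg, neg_div, one_div]]
  rw [fe_S _ _ _ _ (det_zmod γ), this, hz, ch_add, ch_three]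
  generalize u (((γ 0 0 : ℂ) * z + γ 0 1) / ((γ 1 0 : ℂ) * z + γ 1 1)) = X
  generalize ch _ = W
  generalize u z = V
  generalize ((γ 0 0 : ℂ) * z + γ 0 1) = N at *
  generalize ((γ 1 0 : ℂ) * z + γ 1 1) = M at *
  constructor
  · intro h
    field_simp at h
    linear_combination (-h)
  · intro h
    rw [h]
    field_simp

lemma law_T (γ : SL(2, ℤ)) : Law (ModularGroup.T * γ) ↔ Law γ := by
  unfold Law
  refine forall_congr' fun z => ?_
  obtain ⟨h1, h2, h3, h4⟩ := T_ent γ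
  rw [h1, h2, h3, h4, mul_smul, UpperHalfPlane.modular_T_smul]
  have h5 : (((1 : ℝ) +ᵥ (γ • z) : ℍ) : ℂ) = ((γ • z : ℍ) : ℂ) + 1 := by
    simp [add_comm]
  rw [h5, u_T]
  push_cast
  rw [fe_T _ _ _ _ (det_zmod γ), ch_add]
  have := ch_ne_zero 1
  constructor
  · intro h
    apply mul_left_cancel₀ this
    rw [h]; ring
  · intro h
    rw [h]; ring

lemma law (γ : SL(2, ℤ)) : Law γ := by
  have hg : γ ∈ Subgroup.closure {ModularGroup.S, ModularGroup.T} := by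
    simp [SpecialLinearGroup.SL2Z_generators]
  induction hg using Subgroup.closure_induction_left with
  | one =>
    intro z
    have : fe 1 0 0 1 = 0 := by decide
    simp [this, ch_zero]
  | mul_left x hx y hy ih =>
    rcases hx with rfl | hx
    · exact (law_S y).2 ih
    · rw [Set.mem_singleton_iff.1 hx]; exact (law_T y).2 ih
  | inv_mul_cancel x hx y hy ih =>
    rcases hx with rfl | hx
    · rw [← law_S]; simpa using ih
    · rw [Set.mem_singleton_iff.1 hx, ← law_T]; simpa using ih

/-- Transformation law with entries. -/
lemma u_mob (p r s t : ℤ) (h : p * t - r * s = 1) {w : ℂ} (hw : 0 < w.im) :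
    u ((p * w + r) / (s * w + t)) = (s * w + t) ^ 2 * (ch (fe p r s t) * u w) := by
  let γ : SL(2, ℤ) := ⟨!![p, r; s, t], by rw [Matrix.det_fin_two_of]; exact h⟩
  have := law γ ⟨w, hw⟩
  rw [coe_sl] at this
  simpa [γ] using this

lemma mob_ne (s t : ℤ) {w : ℂ} (hw : 0 < w.im) (h : s ≠ 0 ∨ t ≠ 0) : (s * w + t : ℂ) ≠ 0 := by
  intro h0
  have h1 := congrArg Complex.im h0
  simp at h1
  rcases h1 with h1 | h1
  · subst h1
    simp at h0
    simp [h0] at h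
  · exact hw.ne' h1

lemma lin_im (A B D : ℤ) (hA : 0 < A) (hD : 0 < D) {z : ℂ} (hz : 0 < z.im) :
    0 < ((A * z + B) / D : ℂ).im := by
  have : ((A * z + B) / D : ℂ) = (((A / D : ℝ) : ℂ) * z + ((B / D : ℝ) : ℂ)) := by
    push_cast; field_simp
  rw [this, Complex.add_im, Complex.im_ofReal_mul, Complex.ofReal_im, add_zero]
  have : (0 : ℝ) < A := by exact_mod_cast hA
  have : (0 : ℝ) < D := by exact_mod_cast hD
  positivity

end Grid
namespace Grid

/-- Decomposition of `diag(δ,1) * α` as an element of `SL(2,ℤ)` times an upper triangular matrix. -/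
structure Dec (δ : ℤ) (α : SL(2, ℤ)) where
  (p r s t A B D : ℤ)
  (n : ℕ)
  h1 : p * A = δ * α 0 0
  h2 : p * B + r * D = δ * α 0 1
  h3 : s * A = α 1 0
  h4 : s * B + t * D = α 1 1
  hdet : p * t - r * s = 1
  hA : 0 < A
  hD : 0 < D
  hn : n * D = 6 * A

/-- The constant. -/
def Dec.c {δ : ℤ} {α : SL(2, ℤ)} (x : Dec δ α) : ℂ :=
  ch (fe x.p x.r x.s x.t) * Complex.exp (2 * π * Complex.I * (x.B / (6 * x.D))) / x.D ^ 2

/-- The root of unity. -/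
def Dec.e {δ : ℤ} {α : SL(2, ℤ)} (x : Dec δ α) : ℂ :=
  Complex.exp (2 * π * Complex.I * (x.B / x.D))

lemma Dec.norm_e {δ : ℤ} {α : SL(2, ℤ)} (x : Dec δ α) : ‖x.e‖ = 1 := by
  have : (2 * π * Complex.I * (x.B / x.D) : ℂ) = ((2 * π * (x.B / x.D) : ℝ) : ℂ) * Complex.I := by
    push_cast; ring
  rw [Dec.e, this, Complex.norm_exp_ofReal_mul_I]

/-- Local parameter. -/
def qh (h : ℕ+) (z : ℂ) : ℂ := Complex.exp (2 * π * Complex.I * z / h)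

lemma u_qh (A B D : ℤ) (n : ℕ) (hD : 0 < D) (hn : n * D = 6 * A) (z : ℂ) :
    u ((A * z + B) / D) = Complex.exp (2 * π * Complex.I * (B / (6 * D))) * qh 36 z ^ n *
      P (Complex.exp (2 * π * Complex.I * (B / D)) * qh 36 z ^ (6 * n)) ^ 4 := by
  have hD' : (D : ℂ) ≠ 0 := by exact_mod_cast hD.ne'
  have hn' : (n : ℂ) * D = 6 * A := by exact_mod_cast hn
  have hA : (A : ℂ) = n * D / 6 := by rw [hn']; ring
  rw [u_P, qh, ← Complex.exp_nat_mul, ← Complex.exp_nat_mul, ← Complex.exp_add, ← Complex.exp_add,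
    hA]
  congr 4
  · push_cast
    field_simp
    ring
  · push_cast
    field_simp
    ring

lemma u_dec {δ : ℤ} {α : SL(2, ℤ)} (x : Dec δ α) (z : ℍ) :
    u (δ * ((α • z : ℍ) : ℂ)) = ((α 1 0 : ℂ) * z + α 1 1) ^ 2 *
      (x.c * qh 36 z ^ x.n * P (x.e * qh 36 z ^ (6 * x.n)) ^ 4) := by
  have hw := lin_im x.A x.B x.D x.hA x.hD z.im_pos
  have hu := u_mob x.p x.r x.s x.t x.hdet hw
  rw [u_qh _ _ _ _ x.hD x.hn] at hu
  have hD' : (x.D : ℂ) ≠ 0 := by exact_mod_cast x.hD.ne'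
  have e1 : (x.p : ℂ) * x.A = δ * α 0 0 := by exact_mod_cast x.h1
  have e2 : (x.p : ℂ) * x.B + x.r * x.D = δ * α 0 1 := by exact_mod_cast x.h2
  have e3 : (x.s : ℂ) * x.A = α 1 0 := by exact_mod_cast x.h3
  have e4 : (x.s : ℂ) * x.B + x.t * x.D = α 1 1 := by exact_mod_cast x.h4
  have hd := den_ne α z
  have k1 : (x.s * ((x.A * z + x.B) / x.D) + x.t : ℂ) = ((α 1 0 : ℂ) * z + α 1 1) / x.D := by
    rw [← e3, ← e4]; field_simp; ring
  have k2 : (x.p * ((x.A * z + x.B) / x.D) + x.r : ℂ) = δ * ((α 0 0 : ℂ) * z + α 0 1) / x.D := by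
    rw [mul_add, ← mul_assoc, ← e1, ← e2]; field_simp; ring
  rw [k1, k2] at hu
  rw [coe_sl]
  have k3 : (δ * ((α 0 0 : ℂ) * z + α 0 1) / x.D / (((α 1 0 : ℂ) * z + α 1 1) / x.D) : ℂ) =
     δ * (((α 0 0 : ℂ) * z + α 0 1) / ((α 1 0 : ℂ) * z + α 1 1)) := by
    field_simp
  rw [k3] at hu
  rw [hu, Dec.c, Dec.e]
  ring

lemma exists_dec (δ : ℤ) (hδ : 0 < δ) (h6 : δ ∣ 6) (α : SL(2, ℤ)) : Nonempty (Dec δ α) := by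
  have hdet := det_z α
  generalize ha : α 0 0 = a at *
  generalize hb : α 0 1 = b at *
  generalize hc : α 1 0 = c at *
  generalize hd : α 1 1 = d at *
  have hg0 : δ * a ≠ 0 ∨ c ≠ 0 := by
    by_contra! h
    obtain ⟨h1, h2⟩ := h
    have : a = 0 := by
      rcases mul_eq_zero.1 h1 with h | h
      · omega
      · exact h
    simp [this, h2] at hdet
  have hg : 0 < Int.gcd (δ * a) c := Int.gcd_pos_iff.2 hg0
  obtain ⟨p, hp⟩ := Int.gcd_dvd_left (δ * a) c
  obtain ⟨s, hs⟩ := Int.gcd_dvd_right (δ * a) c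
  have hbez := Int.gcd_eq_gcd_ab (δ * a) c
  set g : ℤ := (Int.gcd (δ * a) c : ℤ) with hgdef
  have hg' : 0 < g := by rw [hgdef]; exact Int.natCast_pos.2 hg
  set x := Int.gcdA (δ * a) c
  set y := Int.gcdB (δ * a) c
  have hxy : p * x + s * y = 1 := by
    have : g * (p * x + s * y) = g * 1 := by
      rw [mul_add, ← mul_assoc, ← mul_assoc, ← hp, ← hs, ← hbez, mul_one]
    exact mul_left_cancel₀ hg'.ne' this
  have hgD : g * (p * d - s * (δ * b)) = δ := by
    have : g * (p * d - s * (δ * b)) = (g * p) * d - (g * s) * (δ * b) := by ring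
    rw [this, ← hp, ← hs]
    linear_combination δ * hdet
  have hD : 0 < p * d - s * (δ * b) := by
    by_contra! h
    nlinarith
  have hD6 : (p * d - s * (δ * b)) ∣ 6 := (Dvd.intro_left g hgD).trans h6
  obtain ⟨E, hE⟩ := hD6
  have hE0 : 0 < E := by
    by_contra! h
    nlinarith
  refine ⟨⟨p, -y, s, x, g, x * (δ * b) + y * d, p * d - s * (δ * b), (E * g).toNat,
    ?_, ?_, ?_, ?_, ?_, hg', hD, ?_⟩⟩
  · rw [ha, mul_comm]; exact hp.symm
  · rw [hb]; linear_combination (δ * b) * hxy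
  · rw [hc, mul_comm]; exact hs.symm
  · rw [hd]; linear_combination d * hxy
  · linear_combination hxy
  · rw [Int.toNat_of_nonneg (by positivity), hE]; ring

lemma P_diff : DifferentiableOn ℂ P (Metric.ball 0 1) :=
  ModularForm.differentiableOn_tprod_one_sub_pow

lemma P_zero : P 0 = 1 := by simp [P]

lemma P_ne {q : ℂ} (hq : ‖q‖ < 1) : P q ≠ 0 := by
  refine tprod_one_add_ne_zero_of_summable (f := fun n ↦ -q ^ (n + 1)) ?_ ?_
  · intro n h
    have h1 : q ^ (n + 1) = 1 := by linear_combination -h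
    have h2 := congrArg norm h1
    rw [norm_pow, norm_one] at h2
    exact (pow_lt_one₀ (norm_nonneg _) hq (Nat.succ_ne_zero n)).ne h2
  · simpa using (summable_nat_add_iff 1).mpr (summable_geometric_of_lt_one (norm_nonneg _) hq)

lemma qh_norm (h : ℕ+) (z : ℍ) : ‖qh h z‖ < 1 := by
  have := Function.Periodic.norm_qParam_lt_one (h := (h : ℝ)) (by positivity) z.im_pos
  simpa [qh, Function.Periodic.qParam] using this

lemma comp_ball {e : ℂ} (he : ‖e‖ = 1) {k : ℕ} (hk : 0 < k) {q : ℂ} (hq : q ∈ Metric.ball (0 : ℂ) 1) :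
    e * q ^ k ∈ Metric.ball (0 : ℂ) 1 := by
  rw [mem_ball_zero_iff] at hq ⊢
  rw [norm_mul, he, one_mul, norm_pow]
  exact pow_lt_one₀ (norm_nonneg _) hq hk.ne'

lemma P_comp_diff {e : ℂ} (he : ‖e‖ = 1) {k : ℕ} (hk : 0 < k) :
    DifferentiableOn ℂ (fun q => P (e * q ^ k)) (Metric.ball 0 1) :=
  P_diff.comp (f := fun q : ℂ => e * q ^ k) (by fun_prop) (fun _ hq => comp_ball he hk hq)

lemma P_comp_ne {e : ℂ} (he : ‖e‖ = 1) {k : ℕ} (hk : 0 < k) {q : ℂ} (hq : q ∈ Metric.ball (0 : ℂ) 1) :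
    P (e * q ^ k) ≠ 0 := P_ne (mem_ball_zero_iff.1 (comp_ball he hk hq))

lemma exp_of (h : ℕ+) (f : ℍ → ℂ) (m : ℤ) (G : ℂ → ℂ) (hG : DifferentiableOn ℂ G (Metric.ball 0 1))
    (hf : ∀ z : ℍ, f z = qh h z ^ m * G (qh h z)) :
    ∃ a : ℤ → ℂ, HasExpansion h f a ∧ (∀ n < m, a n = 0) ∧
      ∀ k : ℕ, a (m + k) = iteratedDeriv k G 0 / (k.factorial : ℂ) := by
  refine ⟨fun n => if n < m then 0 else
    iteratedDeriv (n - m).toNat G 0 / ((n - m).toNat.factorial : ℂ), ?_, ?_, ?_⟩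
  · intro z
    have hs := Complex.hasSum_taylorSeries_on_ball hG (mem_ball_zero_iff.2 (qh_norm h z))
    have hq0 : qh h z ≠ 0 := Complex.exp_ne_zero _
    have hinj : Function.Injective (fun k : ℕ => m + (k : ℤ)) := by
      intro x y hxy; simpa using hxy
    rw [hf, ← hs.tsum_eq, ← tsum_mul_left, ← hinj.tsum_eq]
    · refine tsum_congr fun k => ?_
      have h1 : ¬ (m + (k : ℤ) < m) := by omega
      simp only [h1, if_false, add_sub_cancel_left, Int.toNat_natCast, sub_zero, smul_eq_mul]
      have h2 : Complex.exp (2 * π * Complex.I * ((m + (k : ℤ) : ℤ) : ℂ) * z / h) =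
          qh h z ^ m * qh h z ^ k := by
        rw [← zpow_natCast, ← zpow_add₀ hq0, qh, ← Complex.exp_int_mul]
        congr 1
        ring
      rw [h2]
      field_simp
    · intro n hn
      by_cases hnm : n < m
      · simp [hnm] at hn
      · exact ⟨(n - m).toNat, by simp; omega⟩
  · intro n hn
    simp [hn]
  · intro k
    simp

lemma slash0 (f : ℍ → ℂ) (γ : SL(2, ℤ)) (z : ℍ) : (f ∣[(0 : ℤ)] γ) z = f (γ • z) := by
  rw [ModularForm.SL_slash_apply]
  simp

lemma Dec.n_pos {δ : ℤ} {α : SL(2, ℤ)} (x : Dec δ α) : 0 < x.n := by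
  have h1 := x.hn
  have h2 := x.hA
  rcases Nat.eq_zero_or_pos x.n with h | h
  · rw [h] at h1; simp at h1; omega
  · exact h

lemma cusp_exp (α : SL(2, ℤ)) (x1 : Dec 1 α) (x2 : Dec 2 α) (x3 : Dec 3 α) (x6 : Dec 6 α) :
    ∃ a : ℤ → ℂ, HasExpansion 36 (psi6 ∣[(0 : ℤ)] α) a ∧
      (∀ n < (2 * x2.n + x3.n - x1.n - 2 * x6.n : ℤ), a n = 0) ∧
      a (2 * x2.n + x3.n - x1.n - 2 * x6.n : ℤ) = x2.c ^ 2 * x3.c / (x1.c * x6.c ^ 2) := by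
  have k1 : 0 < 6 * x1.n := by have := x1.n_pos; omega
  have k2 : 0 < 6 * x2.n := by have := x2.n_pos; omega
  have k3 : 0 < 6 * x3.n := by have := x3.n_pos; omega
  have k6 : 0 < 6 * x6.n := by have := x6.n_pos; omega
  have key := exp_of 36 (psi6 ∣[(0 : ℤ)] α) (2 * x2.n + x3.n - x1.n - 2 * x6.n : ℤ)
    (fun q => x2.c ^ 2 * x3.c / (x1.c * x6.c ^ 2) *
      (P (x2.e * q ^ (6 * x2.n)) ^ 8 * P (x3.e * q ^ (6 * x3.n)) ^ 4 /
      (P (x1.e * q ^ (6 * x1.n)) ^ 4 * P (x6.e * q ^ (6 * x6.n)) ^ 8))) ?_ ?_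
  · obtain ⟨a, h1, h2, h3⟩ := key
    refine ⟨a, h1, h2, ?_⟩
    have := h3 0
    simpa [k1.ne', k2.ne', k3.ne', k6.ne', x1.n_pos.ne', x2.n_pos.ne', x3.n_pos.ne', x6.n_pos.ne',
      P_zero] using this
  · refine DifferentiableOn.const_mul (DifferentiableOn.fun_div
      (((P_comp_diff x2.norm_e k2).fun_pow 8).fun_mul ((P_comp_diff x3.norm_e k3).fun_pow 4))
      (((P_comp_diff x1.norm_e k1).fun_pow 4).fun_mul ((P_comp_diff x6.norm_e k6).fun_pow 8)) ?_) _
    intro q hq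
    exact mul_ne_zero (pow_ne_zero _ (P_comp_ne x1.norm_e k1 hq))
      (pow_ne_zero _ (P_comp_ne x6.norm_e k6 hq))
  · intro z
    have e1 := u_dec x1 z
    have e2 := u_dec x2 z
    have e3 := u_dec x3 z
    have e6 := u_dec x6 z
    push_cast at e1 e2 e3 e6
    rw [one_mul] at e1
    rw [slash0, psi6_u, e1, e2, e3, e6]
    have hq0 : qh 36 z ≠ 0 := Complex.exp_ne_zero _
    have hd := den_ne α z
    rw [zpow_sub₀ hq0, zpow_sub₀ hq0, zpow_add₀ hq0, _root_.zpow_mul, _root_.zpow_mul]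
    simp only [zpow_natCast]
    generalize ((α 1 0 : ℂ) * z + α 1 1) = M at *
    generalize P _ = P1
    generalize P _ = P2
    generalize P _ = P3
    generalize P _ = P4
    simp only [zpow_ofNat, ← pow_mul]
    have : ∀ a b c d e f g h: ℂ, (M ^ 2 * a) ^ 2 * (M ^ 2 * b) / (M ^ 2 * c * (M ^ 2 * d) ^ 2) =
       a ^ 2 * b / (c * d ^ 2) := by
      intros
      rw [show ∀ a b : ℂ, (M ^ 2 * a) ^ 2 * (M ^ 2 * b) = M ^ 6 * (a ^ 2 * b) by intros; ring,
        show ∀ a b : ℂ, (M ^ 2 * a) * (M ^ 2 * b) ^ 2 = M ^ 6 * (a * b ^ 2) by intros; ring,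
        mul_div_mul_left _ _ (pow_ne_zero 6 hd)]
    rw [this]
    · ring
    all_goals exact 0

end Grid
namespace Grid
open Asymptotics Topology

/-- Congruence modulo `q^5` near zero. -/
def Eq5 (f g : ℂ → ℂ) : Prop := (fun q => f q - g q) =O[𝓝 0] fun q : ℂ => q ^ 5

lemma Eq5.trans {f g h : ℂ → ℂ} (h1 : Eq5 f g) (h2 : Eq5 g h) : Eq5 f h := by
  unfold Eq5 at *
  refine (h1.add h2).congr_left fun q => ?_
  ring

lemma eq5_of (f g r : ℂ → ℂ) (hr : ContinuousAt r 0) (h : ∀ q, f q - g q = q ^ 5 * r q) :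
    Eq5 f g := by
  have h1 : r =O[𝓝 0] fun _ : ℂ => (1 : ℂ) := hr.isBigO_one ℂ
  have := (isBigO_refl (fun q : ℂ => q ^ 5) (𝓝 0)).mul h1
  exact this.congr (fun q => (h q).symm) (fun q => mul_one _)

lemma Eq5.mul {f g f₂ g₂ : ℂ → ℂ} (h1 : Eq5 f g) (h2 : Eq5 f₂ g₂) (hf : ContinuousAt f 0)
    (hg : ContinuousAt g₂ 0) : Eq5 (fun q => f q * f₂ q) (fun q => g q * g₂ q) := by
  have a1 := (hf.isBigO_one ℂ).mul h2
  have a2 := IsBigO.mul h1 (hg.isBigO_one ℂ)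
  simp only [one_mul, mul_one] at a1 a2
  refine (a1.add a2).congr_left fun q => ?_
  ring

lemma Eq5.sq {f g : ℂ → ℂ} (h1 : Eq5 f g) (hf : ContinuousAt f 0)
    (hg : ContinuousAt g 0) : Eq5 (fun q => f q ^ 2) (fun q => g q ^ 2) := by
  simpa only [pow_two] using h1.mul h1 hf hg

lemma R5 : Eq5 (fun q => ∏' n : ℕ, (1 - q ^ (n + 5))) (fun _ => 1) := by
  refine IsBigO.of_bound 4 ?_
  filter_upwards [Metric.ball_mem_nhds (0 : ℂ) (by norm_num : (0 : ℝ) < 1 / 2)] with q hq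
  rw [mem_ball_zero_iff] at hq
  have hq1 : ‖q‖ < 1 := by linarith
  have hq0 := norm_nonneg q
  have hm : Multipliable fun n : ℕ ↦ 1 - q ^ (n + 5) := by
    apply multipliable_one_add_of_summable (f := fun n ↦ -q ^ (n + 5))
    simpa using (summable_nat_add_iff 5).mpr (summable_geometric_of_lt_one (norm_nonneg _) hq1)
  have ht := (hm.hasProd.tendsto_prod_nat.sub_const 1).norm
  refine le_of_tendsto ht (Filter.Eventually.of_forall fun N => ?_)
  have h1 := Finset.norm_prod_one_add_sub_one_le (Finset.range N) (fun n => -q ^ (n + 5))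
  have h2 : ∑ i ∈ Finset.range N, ‖-q ^ (i + 5)‖ ≤ 2 * ‖q‖ ^ 5 := by
    have h3 : ∑ i ∈ Finset.range N, ‖-q ^ (i + 5)‖ = (∑ i ∈ Finset.range N, ‖q‖ ^ i) * ‖q‖ ^ 5 := by
      rw [Finset.sum_mul]
      refine Finset.sum_congr rfl fun i _ => ?_
      rw [norm_neg, norm_pow, pow_add]
    rw [h3]
    refine mul_le_mul_of_nonneg_right ?_ (by positivity)
    have h4 := (summable_geometric_of_lt_one hq0 hq1).sum_le_tsum (Finset.range N)
      (fun _ _ => by positivity)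
    rw [tsum_geometric_of_lt_one hq0 hq1] at h4
    refine h4.trans ?_
    rw [inv_le_comm₀ (by linarith) (by norm_num)]
    linarith
  have h5 : ‖q‖ ^ 5 ≤ (1 / 2) ^ 5 := pow_le_pow_left₀ hq0 hq.le 5
  have h6 : 0 ≤ ∑ i ∈ Finset.range N, ‖-q ^ (i + 5)‖ := Finset.sum_nonneg fun _ _ => norm_nonneg _
  have h7 := Real.abs_exp_sub_one_le (x := ∑ i ∈ Finset.range N, ‖-q ^ (i + 5)‖)
    (by rw [abs_of_nonneg h6]; norm_num at h5; linarith)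
  rw [abs_of_nonneg h6] at h7
  have h8 := (le_abs_self _).trans h7
  simp only [← sub_eq_add_neg] at h1
  rw [norm_pow]
  linarith

lemma tprod_step (f g : ℕ → ℂ) (hg : Multipliable g) (h : ∀ n, f (n + 1) = g n) :
    ∏' n, f n = f 0 * ∏' n, g n := by
  obtain rfl : (fun n => f (n + 1)) = g := funext h
  exact tprod_eq_zero_mul' hg

lemma P_split {q : ℂ} (hq : ‖q‖ < 1) :
    P q = ((1 - q) * (1 - q ^ 2) * (1 - q ^ 3) * (1 - q ^ 4)) * ∏' n : ℕ, (1 - q ^ (n + 5)) := by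
  have hs : ∀ k : ℕ, Multipliable fun n : ℕ ↦ 1 - q ^ (n + k) := by
    intro k
    apply multipliable_one_add_of_summable (f := fun n ↦ -q ^ (n + k))
    simpa using (summable_nat_add_iff k).mpr (summable_geometric_of_lt_one (norm_nonneg _) hq)
  have hstep : ∀ k : ℕ, ∏' n : ℕ, (1 - q ^ (n + k)) = (1 - q ^ k) * ∏' n : ℕ, (1 - q ^ (n + (k + 1))) := by
    intro k
    have h1 := tprod_step (fun n => 1 - q ^ (n + k)) (fun n => 1 - q ^ (n + (k + 1))) (hs (k + 1))
      (fun n => by rw [add_right_comm, add_assoc])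
    rw [h1]
    simp only [zero_add]
  rw [P, hstep 1, hstep 2, hstep 3, hstep 4, pow_one]
  simp only [mul_assoc]

lemma P5 : Eq5 P (fun q => 1 - q - q ^ 2) := by
  have h1 : Eq5 (fun q => ((1 - q) * (1 - q ^ 2) * (1 - q ^ 3) * (1 - q ^ 4)) *
      ∏' n : ℕ, (1 - q ^ (n + 5))) (fun q => ((1 - q) * (1 - q ^ 2) * (1 - q ^ 3) * (1 - q ^ 4)) * 1) := by
    refine Eq5.mul (f := fun q => (1 - q) * (1 - q ^ 2) * (1 - q ^ 3) * (1 - q ^ 4))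
      (g := fun q => (1 - q) * (1 - q ^ 2) * (1 - q ^ 3) * (1 - q ^ 4)) ?_ R5 (by fun_prop) (by fun_prop)
    exact eq5_of _ _ (fun _ => 0) (by fun_prop) (by intro q; simp)
  have h2 : Eq5 (fun q => ((1 - q) * (1 - q ^ 2) * (1 - q ^ 3) * (1 - q ^ 4)) * 1)
      (fun q => 1 - q - q ^ 2) :=
    eq5_of _ _ (fun q => 2 - q ^ 3 - q ^ 4 + q ^ 5) (by fun_prop) (by intro q; ring)
  have h3 := h1.trans h2
  unfold Eq5 at h3 ⊢
  refine IsBigO.congr' h3 ?_ (Filter.EventuallyEq.refl _ _)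
  filter_upwards [Metric.ball_mem_nhds (0 : ℂ) (by norm_num : (0 : ℝ) < 1)] with q hq
  rw [mem_ball_zero_iff] at hq
  rw [P_split hq]

lemma Eq5.comp {f g : ℂ → ℂ} (h : Eq5 f g) (k : ℕ) :
    Eq5 (fun q => f (q ^ (k + 1))) (fun q => g (q ^ (k + 1))) := by
  have ht : Filter.Tendsto (fun q : ℂ => q ^ (k + 1)) (𝓝 0) (𝓝 0) := by
    have : ContinuousAt (fun q : ℂ => q ^ (k + 1)) 0 := by fun_prop
    simpa [ContinuousAt] using this
  have h1 := h.comp_tendsto ht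
  refine h1.trans ?_
  have := eq5_of (fun q => (q ^ (k + 1)) ^ 5) (fun _ => 0) (fun q => (q ^ k) ^ 5) (by fun_prop)
    (by intro q; ring)
  unfold Eq5 at this
  simp only [sub_zero] at this
  exact this

lemma P_cont : ContinuousAt P 0 :=
  (P_diff.differentiableAt (Metric.ball_mem_nhds _ one_pos)).continuousAt

lemma P_cont_pow (k : ℕ) : ContinuousAt (fun q : ℂ => P (q ^ (k + 1))) 0 := by
  have : ContinuousAt (fun q : ℂ => q ^ (k + 1)) 0 := by fun_prop
  refine ContinuousAt.comp (g := P) ?_ this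
  simpa using P_cont

/-- The normalized series at infinity. -/
def G (q : ℂ) : ℂ := P (q ^ 2) ^ 8 * P (q ^ 3) ^ 4 / (P q ^ 4 * P (q ^ 6) ^ 8)

lemma pow4 {f : ℂ → ℂ} : (fun q => f q ^ 4) = fun q => (f q ^ 2) ^ 2 := by
  ext; ring

lemma pow8 {f : ℂ → ℂ} : (fun q => f q ^ 8) = fun q => ((f q ^ 2) ^ 2) ^ 2 := by
  ext; ring

lemma N5 : Eq5 (fun q => P (q ^ 2) ^ 8 * P (q ^ 3) ^ 4) (fun q => 1 - 8 * q ^ 2 - 4 * q ^ 3 + 20 * q ^ 4) := by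
  have c2 := P_cont_pow 1
  have c3 := P_cont_pow 2
  have a1 : Eq5 (fun q => P (q ^ 2) ^ 8) (fun q => 1 - 8 * q ^ 2 + 20 * q ^ 4) := by
    rw [pow8]
    have s1 := (P5.comp 1).sq c2 (by fun_prop)
    have s2 := s1.trans (eq5_of _ (fun q => 1 - 2 * q ^ 2 - q ^ 4) (fun q => 2 * q + q ^ 3)
      (by fun_prop) (by intro q; ring))
    have s3 := (s2.sq (c2.pow 2) (by fun_prop)).trans (eq5_of _ (fun q => 1 - 4 * q ^ 2 + 2 * q ^ 4)
      (fun q => 4 * q + q ^ 3) (by fun_prop) (by intro q; ring))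
    exact (s3.sq ((c2.pow 2).pow 2) (by fun_prop)).trans (eq5_of _ _
      (fun q => -16 * q + 4 * q ^ 3) (by fun_prop) (by intro q; ring))
  have a2 : Eq5 (fun q => P (q ^ 3) ^ 4) (fun q => 1 - 4 * q ^ 3) := by
    rw [pow4]
    have s1 := (P5.comp 2).trans (eq5_of _ (fun q => 1 - q ^ 3) (fun q => - q)
      (by fun_prop) (by intro q; ring))
    have s2 := (s1.sq c3 (by fun_prop)).sq (c3.pow 2) (by fun_prop)
    exact s2.trans (eq5_of _ _ (fun q => 6 * q - 4 * q ^ 4 + q ^ 7) (by fun_prop) (by intro q; ring))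
  exact (a1.mul a2 (c2.pow 8) (by fun_prop)).trans (eq5_of _ _ (fun q => 32 - 80 * q ^ 2)
    (by fun_prop) (by intro q; ring))

lemma D5 : Eq5 (fun q => P q ^ 4 * P (q ^ 6) ^ 8)
    (fun q => 1 - 4 * q + 2 * q ^ 2 + 8 * q ^ 3 - 5 * q ^ 4) := by
  have c1 := P_cont
  have c6 := P_cont_pow 5
  have a1 : Eq5 (fun q => P q ^ 4) (fun q => 1 - 4 * q + 2 * q ^ 2 + 8 * q ^ 3 - 5 * q ^ 4) := by
    rw [pow4]
    exact ((P5.sq c1 (by fun_prop)).sq (c1.pow 2) (by fun_prop)).trans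
      (eq5_of _ _ (fun q => -8 + 2 * q + 4 * q ^ 2 + q ^ 3) (by fun_prop) (by intro q; ring))
  have a2 : Eq5 (fun q => P (q ^ 6) ^ 8) (fun _ => 1) := by
    rw [pow8]
    have s1 := (P5.comp 5).trans (eq5_of _ (fun q => 1) (fun q => - q - q ^ 7)
      (by fun_prop) (by intro q; ring))
    have s2 := ((s1.sq c6 (by fun_prop)).sq (c6.pow 2) (by fun_prop)).sq ((c6.pow 2).pow 2) (by fun_prop)
    simpa using s2
  simpa using (a1.mul a2 (c1.pow 4) (by fun_prop))

lemma G5 : Eq5 G (fun q => 1 + 4 * q + 6 * q ^ 2 + 4 * q ^ 3 - 3 * q ^ 4) := by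
  have c1 := P_cont
  have c6 := P_cont_pow 5
  have cD : ContinuousAt (fun q => P q ^ 4 * P (q ^ 6) ^ 8) 0 := (c1.pow 4).mul (c6.pow 8)
  have hD0 : P 0 ^ 4 * P (0 ^ 6) ^ 8 ≠ 0 := by simp [P_zero]
  have cI : ContinuousAt (fun q => (P q ^ 4 * P (q ^ 6) ^ 8)⁻¹) 0 := cD.inv₀ hD0
  have h0 : ∀ᶠ q in 𝓝 (0 : ℂ), P q ^ 4 * P (q ^ 6) ^ 8 ≠ 0 := cD.eventually_ne hD0
  have h1 : Eq5 (fun q => (P q ^ 4 * P (q ^ 6) ^ 8) * (1 + 4 * q + 6 * q ^ 2 + 4 * q ^ 3 - 3 * q ^ 4))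
      (fun q => (1 - 4 * q + 2 * q ^ 2 + 8 * q ^ 3 - 5 * q ^ 4) *
        (1 + 4 * q + 6 * q ^ 2 + 4 * q ^ 3 - 3 * q ^ 4)) :=
    D5.mul (eq5_of _ _ (fun _ => 0) (by fun_prop) (by intro q; ring)) cD (by fun_prop)
  have h2 : Eq5 (fun q => 1 - 8 * q ^ 2 - 4 * q ^ 3 + 20 * q ^ 4)
      (fun q => (1 - 4 * q + 2 * q ^ 2 + 8 * q ^ 3 - 5 * q ^ 4) *
        (1 + 4 * q + 6 * q ^ 2 + 4 * q ^ 3 - 3 * q ^ 4)) :=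
    eq5_of _ _ (fun q => -(48 - 4 * q - 44 * q ^ 2 + 15 * q ^ 3)) (by fun_prop) (by intro q; ring)
  have h3 : Eq5 (fun q => P (q ^ 2) ^ 8 * P (q ^ 3) ^ 4)
      (fun q => (P q ^ 4 * P (q ^ 6) ^ 8) * (1 + 4 * q + 6 * q ^ 2 + 4 * q ^ 3 - 3 * q ^ 4)) := by
    refine (N5.trans h2).trans ?_
    unfold Eq5 at h1 ⊢
    exact h1.symm
  have h4 := IsBigO.mul h3 (cI.isBigO_one ℂ)
  simp only [mul_one] at h4
  refine h4.congr' ?_ (Filter.EventuallyEq.refl _ _)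
  filter_upwards [h0] with q hq
  rw [G]
  generalize P q ^ 4 * P (q ^ 6) ^ 8 = D at *
  rw [sub_mul, div_eq_mul_inv, mul_right_comm D, mul_inv_cancel₀ hq, one_mul]

lemma coeff_zero_of_isBigO (n : ℕ) : ∀ d : ℕ → ℂ,
    (fun q : ℂ => ∑ k ∈ Finset.range n, d k * q ^ k) =O[𝓝[≠] 0] (fun q : ℂ => q ^ n) →
    ∀ k < n, d k = 0 := by
  induction n with
  | zero => intro d _ k hk; omega
  | succ n ih =>
    intro d h
    have ht : Filter.Tendsto (fun q : ℂ => ∑ k ∈ Finset.range (n + 1), d k * q ^ k)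
        (𝓝[≠] 0) (𝓝 (d 0)) := by
      have : ContinuousAt (fun q : ℂ => ∑ k ∈ Finset.range (n + 1), d k * q ^ k) 0 := by fun_prop
      have h2 := this.tendsto
      simp only [Finset.sum_range_succ', pow_zero, mul_one] at h2 ⊢
      simp at h2
      exact h2.mono_left nhdsWithin_le_nhds
    have hq : Filter.Tendsto (fun q : ℂ => q ^ (n + 1)) (𝓝[≠] 0) (𝓝 0) := by
      have : ContinuousAt (fun q : ℂ => q ^ (n + 1)) 0 := by fun_prop
      have h2 := this.tendsto
      simp at h2
      exact h2.mono_left nhdsWithin_le_nhds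
    have hd0 : d 0 = 0 := tendsto_nhds_unique ht (h.trans_tendsto hq)
    have h3 := ih (fun k => d (k + 1)) ?_
    · intro k hk
      rcases k with _ | k
      · exact hd0
      · exact h3 k (by omega)
    · have := (isBigO_refl (fun q : ℂ => q⁻¹) (𝓝[≠] 0)).mul h
      refine this.congr' ?_ ?_
      · filter_upwards [self_mem_nhdsWithin] with q hq
        have hq' : q ≠ 0 := hq
        rw [Finset.sum_range_succ', hd0, zero_mul, add_zero, Finset.mul_sum]
        refine Finset.sum_congr rfl fun k _ => ?_
        field_simp
        try ring
      · filter_upwards [self_mem_nhdsWithin] with q hq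
        have hq' : q ≠ 0 := hq
        field_simp
        try ring

lemma G_diff : DifferentiableOn ℂ G (Metric.ball 0 1) := by
  have h := fun k (hk : 0 < k) => P_comp_diff (e := 1) (by simp) (k := k) hk
  have hne := fun k (hk : 0 < k) (q : ℂ) hq => P_comp_ne (e := 1) (by simp) (k := k) hk (q := q) hq
  simp only [one_mul] at h hne
  have e1 := h 1 (by norm_num)
  have n1 := hne 1 (by norm_num)
  simp only [pow_one] at e1 n1
  exact DifferentiableOn.fun_div (((h 2 (by norm_num)).fun_pow 8).fun_mul ((h 3 (by norm_num)).fun_pow 4))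
    ((e1.fun_pow 4).fun_mul ((h 6 (by norm_num)).fun_pow 8))
    fun q hq => mul_ne_zero (pow_ne_zero _ (n1 q hq)) (pow_ne_zero _ (hne 6 (by norm_num) q hq))

/-- Initial coefficients. -/
def gc : ℕ → ℂ
  | 0 => 1
  | 1 => 4
  | 2 => 6
  | 3 => 4
  | 4 => -3
  | _ => 0

lemma G_coeff (k : ℕ) (hk : k < 5) : iteratedDeriv k G 0 / (k.factorial : ℂ) = gc k := by
  have ha : AnalyticAt ℂ G 0 := G_diff.analyticAt (Metric.ball_mem_nhds _ one_pos)
  have h1 := ha.hasFPowerSeriesAt.isBigO_sub_partialSum_pow 5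
  have h2 : (fun q : ℂ => G q - ∑ k ∈ Finset.range 5, iteratedDeriv k G 0 / (k.factorial : ℂ) * q ^ k)
      =O[𝓝 0] fun q : ℂ => q ^ 5 := by
    refine (h1.congr_left fun q => ?_).trans ?_
    · simp [FormalMultilinearSeries.partialSum, FormalMultilinearSeries.ofScalars, mul_comm]
    · exact IsBigO.of_bound 1 (by simp)
  have h3 := (IsBigO.sub G5 h2).mono (nhdsWithin_le_nhds (s := {0}ᶜ))
  have h4 := coeff_zero_of_isBigO 5
    (fun k => iteratedDeriv k G 0 / (k.factorial : ℂ) - gc k) (h3.congr_left ?_) k hk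
  · exact sub_eq_zero.1 h4
  · intro q
    simp only [Finset.sum_range_succ, Finset.sum_range_zero, gc]
    ring

lemma psi_inf : ∃ a : ℤ → ℂ, HasExpansion 1 psi6 a ∧ (∀ n < (-1 : ℤ), a n = 0) ∧
        a (-1) = 1 ∧ a 0 = 4 ∧ a 1 = 6 ∧ a 2 = 4 ∧ a 3 = -3 := by
  have key := exp_of 1 psi6 (-1) G G_diff ?_
  · obtain ⟨a, h1, h2, h3⟩ := key
    refine ⟨a, h1, h2, ?_, ?_, ?_, ?_, ?_⟩
    · have := h3 0; rw [G_coeff 0 (by norm_num)] at this; simpa [gc] using this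
    · have := h3 1; rw [G_coeff 1 (by norm_num)] at this; simpa [gc] using this
    · have := h3 2; rw [G_coeff 2 (by norm_num)] at this; simpa [gc] using this
    · have := h3 3; rw [G_coeff 3 (by norm_num)] at this; simpa [gc] using this
    · have := h3 4; rw [G_coeff 4 (by norm_num)] at this; simpa [gc] using this
  · intro z
    have hq : qh 1 z = Complex.exp (2 * π * Complex.I * z) := by simp [qh]
    have hk : ∀ k : ℕ, Complex.exp (2 * π * Complex.I * (k * z)) = qh 1 z ^ k := by
      intro k
      rw [hq, ← Complex.exp_nat_mul]; congr 1; ring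
    have hx : ∀ k : ℕ, Complex.exp (2 * π * Complex.I * (k * z) / 6) =
        Complex.exp (2 * π * Complex.I * z / 6) ^ k := by
      intro k
      rw [← Complex.exp_nat_mul]; congr 1; ring
    have hy : qh 1 z = Complex.exp (2 * π * Complex.I * z / 6) ^ 6 := by
      rw [hq, ← Complex.exp_nat_mul]; congr 1; push_cast; ring
    have k2 := hk 2
    have k3 := hk 3
    have k6 := hk 6
    have x2 := hx 2
    have x3 := hx 3
    have x6 := hx 6
    push_cast at k2 k3 k6 x2 x3 x6
    rw [psi6_u, u_P, u_P, u_P, u_P, k2, k3, k6, x2, x3, x6, ← hq, G]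
    have hx0 : Complex.exp (2 * π * Complex.I * z / 6) ≠ 0 := Complex.exp_ne_zero _
    generalize hX : Complex.exp (2 * π * Complex.I * z / 6) = X at *
    have : (qh 1 z ^ (-1 : ℤ)) = (X ^ 6)⁻¹ := by rw [_root_.zpow_neg_one, hy]
    rw [this]
    generalize P _ = P1
    generalize P _ = P2
    generalize P _ = P3
    generalize P _ = P4
    rw [div_eq_mul_inv, div_eq_mul_inv]
    simp only [mul_inv, mul_pow]
    field_simp

end Grid
namespace Grid

lemma u_diff {z : ℂ} (hz : 0 < z.im) : DifferentiableAt ℂ u z := by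
  have := ModularForm.differentiableAt_eta_of_mem_upperHalfPlaneSet hz
  exact this.fun_pow 4

lemma u_diff_mul (k : ℝ) (hk : 0 < k) {z : ℂ} (hz : 0 < z.im) :
    DifferentiableAt ℂ (fun w : ℂ => u ((k : ℂ) * w)) z := by
  have h : 0 < ((k : ℂ) * z).im := by
    rw [Complex.im_ofReal_mul]; positivity
  exact DifferentiableAt.comp z (u_diff h) (by fun_prop)

lemma u_ne_mul (k : ℝ) (hk : 0 < k) {z : ℂ} (hz : 0 < z.im) : u ((k : ℂ) * z) ≠ 0 := by
  refine u_ne_zero ?_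
  rw [Complex.im_ofReal_mul]; positivity

lemma psi_mdiff : MDifferentiable 𝓘(ℂ) 𝓘(ℂ) psi6 := by
  rw [UpperHalfPlane.mdifferentiable_iff]
  have h : DifferentiableOn ℂ (fun z : ℂ => u (2 * z) ^ 2 * u (3 * z) / (u z * u (6 * z) ^ 2))
      {z : ℂ | 0 < z.im} := by
    intro z hz
    have hz' : 0 < z.im := hz
    refine DifferentiableAt.differentiableWithinAt ?_
    have d2 := u_diff_mul 2 (by norm_num) hz'
    have d3 := u_diff_mul 3 (by norm_num) hz'
    have d6 := u_diff_mul 6 (by norm_num) hz'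
    have n6 := u_ne_mul 6 (by norm_num) hz'
    push_cast at d2 d3 d6 n6
    exact DifferentiableAt.fun_div ((d2.fun_pow 2).fun_mul d3) ((u_diff hz').fun_mul (d6.fun_pow 2))
      (mul_ne_zero (u_ne_zero hz') (pow_ne_zero 2 n6))
  refine h.congr fun z hz => ?_
  have hz' : 0 < z.im := hz
  rw [Function.comp_apply, UpperHalfPlane.ofComplex_apply_of_im_pos hz', psi6_u]

lemma u_gamma (k a b c d : ℤ) (hk : 0 < k) (h : a * d - b * (k * c) = 1) {z : ℂ} (hz : 0 < z.im) :
    u (k * ((a * z + b) / ((k * c : ℤ) * z + d))) =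
      ((k * c : ℤ) * z + d) ^ 2 * (ch (fe a (k * b : ℤ) c d) * u (k * z)) := by
  have hw : 0 < ((k : ℂ) * z).im := by
    have := lin_im k 0 1 hk one_pos hz
    simpa using this
  have := u_mob a (k * b) c d (by linear_combination h) hw
  have e1 : (c : ℂ) * (k * z) + d = ((k * c : ℤ) : ℂ) * z + d := by push_cast; ring
  have e2 : ((a : ℂ) * (k * z) + (k * b : ℤ)) / (((k * c : ℤ) : ℂ) * z + d) =
      k * ((a * z + b) / ((k * c : ℤ) * z + d)) := by
    push_cast; ring
  rw [e1, e2] at this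
  exact this

lemma psi_inv (γ : SL(2, ℤ)) (hγ : γ ∈ Gamma0 6) : psi6 ∣[(0 : ℤ)] γ = psi6 := by
  ext z
  rw [slash0, psi6_u, psi6_u, coe_sl]
  rw [Gamma0_mem] at hγ
  have hd := den_ne γ z
  have hdet := det_z γ
  obtain ⟨c, hc⟩ := (ZMod.intCast_zmod_eq_zero_iff_dvd _ 6).1 hγ
  push_cast at hc
  generalize γ 0 0 = a at *
  generalize γ 0 1 = b at *
  generalize γ 1 1 = d at *
  rw [hc] at hdet hd ⊢
  have hz := z.im_pos
  have g1 := u_gamma 1 a b (6 * c) d (by norm_num) (by linear_combination hdet) hz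
  have g2 := u_gamma 2 a b (3 * c) d (by norm_num) (by linear_combination hdet) hz
  have g3 := u_gamma 3 a b (2 * c) d (by norm_num) (by linear_combination hdet) hz
  have g6 := u_gamma 6 a b c d (by norm_num) (by linear_combination hdet) hz
  have r1 : 1 * (6 * c) = 6 * c := by ring
  have r2 : 2 * (3 * c) = 6 * c := by ring
  have r3 : 3 * (2 * c) = 6 * c := by ring
  rw [r1] at g1
  rw [r2] at g2
  rw [r3] at g3
  have six : (6 : ZMod 6) = 0 := by decide
  have hz6 : (a : ZMod 6) * d = 1 := by
    have := congrArg (Int.cast : ℤ → ZMod 6) hdet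
    push_cast at this
    rw [six] at this
    simpa using this
  have hf := congrArg ch (fe_gamma a b c d hz6)
  have two_ch : ∀ x : ZMod 6, ch (2 * x) = ch x ^ 2 := by
    intro x
    rw [two_mul, ch_add, pow_two]
  rw [ch_add, ch_add, two_ch, two_ch] at hf
  push_cast at g1 g2 g3 g6 hd ⊢
  rw [six, zero_mul] at g1
  simp only [one_mul] at g1
  rw [g1, g2, g3, g6]
  have n1 := ch_ne_zero (fe a b 0 d)
  have n6 := ch_ne_zero (fe a (6 * b) c d)
  generalize ch (fe a (2 * b) (3 * c) d) = X2 at *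
  generalize ch (fe a (3 * b) (2 * c) d) = X3 at *
  generalize ch (fe a b 0 d) = X1 at *
  generalize ch (fe a (6 * b) c d) = X6 at *
  have m1 := u_ne_zero hz
  have m6 := u_ne_mul 6 (by norm_num) hz
  push_cast at m6
  generalize u (2 * (z : ℂ)) = U2 at *
  generalize u (3 * (z : ℂ)) = U3 at *
  generalize u (6 * (z : ℂ)) = U6 at *
  generalize u (z : ℂ) = U1 at *
  generalize (6 * c * (z : ℂ) + d) = M at *
  rw [div_eq_div_iff (by simp [*]) (by simp [*])]
  linear_combination (M ^ 6 * U2 ^ 2 * U3 * U1 * U6 ^ 2) * hf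

lemma psi_merom (α : SL(2, ℤ)) : MeromAtCusp 0 psi6 α := by
  obtain ⟨x1⟩ := exists_dec 1 (by norm_num) (by norm_num) α
  obtain ⟨x2⟩ := exists_dec 2 (by norm_num) (by norm_num) α
  obtain ⟨x3⟩ := exists_dec 3 (by norm_num) (by norm_num) α
  obtain ⟨x6⟩ := exists_dec 6 (by norm_num) (by norm_num) α
  obtain ⟨a, h1, h2, -⟩ := cusp_exp α x1 x2 x3 x6
  exact ⟨36, a, ⟨_, h2⟩, h1⟩

/-- Decompositions at the cusp `0`. -/
def decS (δ : ℤ) (n : ℕ) (hδ : 0 < δ) (hn : n * δ = 6) : Dec δ S :=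
  { p := 0, r := -1, s := 1, t := 0, A := 1, B := 0, D := δ, n := n
    h1 := by simp [S]
    h2 := by simp [S]
    h3 := by simp [S]
    h4 := by simp [S]
    hdet := by norm_num
    hA := by norm_num
    hD := hδ
    hn := by rw [hn]; norm_num }

lemma decS_c (δ : ℤ) (n : ℕ) (hδ : 0 < δ) (hn : n * δ = 6) : (decS δ n hδ hn).c = - 1 / δ ^ 2 := by
  have : fe ((0 : ℤ) : ZMod 6) ((-1 : ℤ) : ZMod 6) ((1 : ℤ) : ZMod 6) ((0 : ℤ) : ZMod 6) = 3 := by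
    decide
  simp only [Dec.c, decS]
  rw [this, ch_three]
  simp

lemma val_S : ∃ (h : ℕ+) (b : ℤ → ℂ), HasExpansion h (psi6 ∣[(0 : ℤ)] S) b ∧
          (∀ n < 0, b n = 0) ∧ b 0 = 9 := by
  obtain ⟨a, h1, h2, h3⟩ := cusp_exp S (decS 1 6 (by norm_num) (by norm_num))
    (decS 2 3 (by norm_num) (by norm_num)) (decS 3 2 (by norm_num) (by norm_num))
    (decS 6 1 (by norm_num) (by norm_num))
  rw [decS_c, decS_c, decS_c, decS_c] at h3
  simp only [decS] at h2 h3
  norm_num at h2 h3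
  exact ⟨36, a, h1, h2, h3⟩

/-- Decomposition at the cusp `1/3`. -/
def dec31 : Dec 1 (L 3) :=
  { p := 1, r := 0, s := 3, t := 1, A := 1, B := 0, D := 1, n := 6
    h1 := by simp [L]
    h2 := by simp [L]
    h3 := by simp [L]
    h4 := by simp [L]
    hdet := by norm_num
    hA := by norm_num
    hD := by norm_num
    hn := by norm_num }

/-- Decomposition at the cusp `1/3`. -/
def dec32 : Dec 2 (L 3) :=
  { p := 2, r := -1, s := 3, t := -1, A := 1, B := 1, D := 2, n := 3
    h1 := by simp [L]
    h2 := by simp [L]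
    h3 := by simp [L]
    h4 := by simp [L]
    hdet := by norm_num
    hA := by norm_num
    hD := by norm_num
    hn := by norm_num }

/-- Decomposition at the cusp `1/3`. -/
def dec33 : Dec 3 (L 3) :=
  { p := 1, r := 0, s := 1, t := 1, A := 3, B := 0, D := 1, n := 18
    h1 := by simp [L]
    h2 := by simp [L]
    h3 := by simp [L]
    h4 := by simp [L]
    hdet := by norm_num
    hA := by norm_num
    hD := by norm_num
    hn := by norm_num }

/-- Decomposition at the cusp `1/3`. -/
def dec36 : Dec 6 (L 3) :=
  { p := 2, r := -1, s := 1, t := 0, A := 3, B := 1, D := 2, n := 9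
    h1 := by simp [L]
    h2 := by simp [L]
    h3 := by simp [L]
    h4 := by simp [L]
    hdet := by norm_num
    hA := by norm_num
    hD := by norm_num
    hn := by norm_num }

lemma val_L3 : ∃ (h : ℕ+) (b : ℤ → ℂ), HasExpansion h (psi6 ∣[(0 : ℤ)] L 3) b ∧
          (∀ n < 0, b n = 0) ∧ b 0 = 1 := by
  obtain ⟨a, h1, h2, h3⟩ := cusp_exp (L 3) dec31 dec32 dec33 dec36
  have f1 : fe ((1 : ℤ) : ZMod 6) ((0 : ℤ) : ZMod 6) ((3 : ℤ) : ZMod 6) ((1 : ℤ) : ZMod 6) = 3 := by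
    decide
  have f2 : fe ((2 : ℤ) : ZMod 6) ((-1 : ℤ) : ZMod 6) ((3 : ℤ) : ZMod 6) ((-1 : ℤ) : ZMod 6) = 4 := by
    decide
  have f3 : fe ((1 : ℤ) : ZMod 6) ((0 : ℤ) : ZMod 6) ((1 : ℤ) : ZMod 6) ((1 : ℤ) : ZMod 6) = 5 := by
    decide
  have f6 : fe ((2 : ℤ) : ZMod 6) ((-1 : ℤ) : ZMod 6) ((1 : ℤ) : ZMod 6) ((0 : ℤ) : ZMod 6) = 5 := by
    decide
  have hch : ch 4 * ch 4 * ch 5 = ch 3 * (ch 5 * ch 5) := by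
    simp only [← ch_add]
    exact congrArg ch (by decide)
  simp only [dec31, dec32, dec33, dec36, Dec.c, f1, f2, f3, f6] at h2 h3
  have n3 := ch_ne_zero 3
  have n5 := ch_ne_zero 5
  have nE := Complex.exp_ne_zero (2 * π * Complex.I * (((1 : ℤ) : ℂ) / (6 * ((2 : ℤ) : ℂ))))
  generalize Complex.exp (2 * π * Complex.I * (((1 : ℤ) : ℂ) / (6 * ((2 : ℤ) : ℂ)))) = E at *
  generalize ch 3 = X3 at *
  generalize ch 4 = X4 at *
  generalize ch 5 = X5 at *
  norm_num at h2
  refine ⟨36, a, h1, h2, ?_⟩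
  have e0 : (2 * ((3 : ℕ) : ℤ) + ((18 : ℕ) : ℤ) - ((6 : ℕ) : ℤ) - 2 * ((9 : ℕ) : ℤ)) = 0 := by norm_num
  rw [e0] at h3
  rw [h3, div_eq_one_iff_eq]
  · simp only [Int.cast_zero, zero_div, mul_zero, Complex.exp_zero, Int.cast_one]
    linear_combination (E / (2 : ℤ) ^ 2) ^ 2 * hch
  · simp [n3, n5, nE]

/-- Decomposition at the cusp `1/2`. -/
def dec21 : Dec 1 (L 2) :=
  { p := 1, r := 0, s := 2, t := 1, A := 1, B := 0, D := 1, n := 6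
    h1 := by simp [L]
    h2 := by simp [L]
    h3 := by simp [L]
    h4 := by simp [L]
    hdet := by norm_num
    hA := by norm_num
    hD := by norm_num
    hn := by norm_num }

/-- Decomposition at the cusp `1/2`. -/
def dec22 : Dec 2 (L 2) :=
  { p := 1, r := 0, s := 1, t := 1, A := 2, B := 0, D := 1, n := 12
    h1 := by simp [L]
    h2 := by simp [L]
    h3 := by simp [L]
    h4 := by simp [L]
    hdet := by norm_num
    hA := by norm_num
    hD := by norm_num
    hn := by norm_num }

/-- Decomposition at the cusp `1/2`. -/
def dec23 : Dec 3 (L 2) :=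
  { p := 3, r := 1, s := 2, t := 1, A := 1, B := -1, D := 3, n := 2
    h1 := by simp [L]
    h2 := by simp [L]
    h3 := by simp [L]
    h4 := by simp [L]
    hdet := by norm_num
    hA := by norm_num
    hD := by norm_num
    hn := by norm_num }

/-- Decomposition at the cusp `1/2`. -/
def dec26 : Dec 6 (L 2) :=
  { p := 3, r := -1, s := 1, t := 0, A := 2, B := 1, D := 3, n := 4
    h1 := by simp [L]
    h2 := by simp [L]
    h3 := by simp [L]
    h4 := by simp [L]
    hdet := by norm_num
    hA := by norm_num
    hD := by norm_num
    hn := by norm_num }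

lemma val_L2 : ∃ (h : ℕ+) (b : ℤ → ℂ), HasExpansion h (psi6 ∣[(0 : ℤ)] L 2) b ∧
          (∀ n < 0, b n = 0) ∧ b 0 = 0 := by
  obtain ⟨a, h1, h2, -⟩ := cusp_exp (L 2) dec21 dec22 dec23 dec26
  simp only [dec21, dec22, dec23, dec26] at h2
  norm_num at h2
  exact ⟨36, a, h1, fun n hn => h2 n (by omega), h2 0 (by norm_num)⟩

end Grid

/-- `ψ⁽⁶⁾` is a weakly holomorphic modular function for `Γ₀(6)` with a simple pole at `∞`,
`q`-expansion `q⁻¹ + 4 + 6q + 4q² - 3q³ + ⋯`, and its values at the cusps `0`, `1/3`, `1/2`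
are exactly the roots `0, 1, 9` of `x³ - 10x² + 9x`. -/
theorem statement_12 :
    IsWeaklyHol 6 0 psi6 ∧
      (∃ a : ℤ → ℂ, HasExpansion 1 psi6 a ∧ (∀ n < (-1 : ℤ), a n = 0) ∧
        a (-1) = 1 ∧ a 0 = 4 ∧ a 1 = 6 ∧ a 2 = 4 ∧ a 3 = -3) ∧
      ∃ v0 v13 v12 : ℂ,
        (∃ (h : ℕ+) (b : ℤ → ℂ), HasExpansion h (psi6 ∣[(0 : ℤ)] S) b ∧
          (∀ n < 0, b n = 0) ∧ b 0 = v0) ∧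
        (∃ (h : ℕ+) (b : ℤ → ℂ), HasExpansion h (psi6 ∣[(0 : ℤ)] L 3) b ∧
          (∀ n < 0, b n = 0) ∧ b 0 = v13) ∧
        (∃ (h : ℕ+) (b : ℤ → ℂ), HasExpansion h (psi6 ∣[(0 : ℤ)] L 2) b ∧
          (∀ n < 0, b n = 0) ∧ b 0 = v12) ∧
        ({v0, v13, v12} : Set ℂ) = {0, 1, 9} ∧
        ∀ x ∈ ({v0, v13, v12} : Set ℂ), x ^ 3 - 10 * x ^ 2 + 9 * x = 0 := by
  refine ⟨⟨Grid.psi_mdiff, fun γ => Grid.psi_inv γ γ.2, Grid.psi_merom⟩, Grid.psi_inf, 9, 1, 0,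
    Grid.val_S, Grid.val_L3, Grid.val_L2, ?_, ?_⟩
  · ext x
    simp only [Set.mem_insert_iff, Set.mem_singleton_iff]
    tauto
  · intro x hx
    simp only [Set.mem_insert_iff, Set.mem_singleton_iff] at hx
    rcases hx with rfl | rfl | rfl <;> norm_num
end
end

section
/- The eta quotient \eta(9z)^6/\eta(3z)^2 is a holomorphic modular form of weight 2 for \Gamma_0(9) vanishing to order 2 at \infty, with q-expansion q^2 + 2q^5 + 5q^8 + 4q^{11} + 8q^{14} + \cdots; in particular all exponents with nonzero coefficient are \equiv 2 mod 3. -/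
noncomputable section
open Complex UpperHalfPlane Matrix ModularForm CongruenceSubgroup Filter
open scoped ModularForm MatrixGroups Manifold Real

open Grid


namespace EtaQuot

/-- Multiplication by a positive real on the upper half plane. -/
def sc (r : ℝ) (hr : 0 < r) (z : ℍ) : ℍ := ⟨(r : ℂ) * z, by
  simpa using mul_pos hr z.im_pos⟩

lemma coe_sc (r : ℝ) (hr : 0 < r) (z : ℍ) : ((sc r hr z : ℍ) : ℂ) = r * z := rfl

lemma im_sc (r : ℝ) (hr : 0 < r) (z : ℍ) : (sc r hr z).im = r * z.im := by
  rw [← UpperHalfPlane.coe_im, coe_sc]; simp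

lemma grid_eta (z : ℂ) : Grid.eta z = ModularForm.eta z := by
  unfold Grid.eta ModularForm.eta
  congr 1
  · simp only [Function.Periodic.qParam]; congr 1; push_cast; ring
  · rw [tprod_pnat_eq_tprod_succ (f := fun n => 1 - qc z ^ n)]
    simp [Grid.qc, ModularForm.eta_q, Function.Periodic.qParam]

lemma eta_sq_S (z : ℂ) (hz : 0 < z.im) :
    ModularForm.eta (-1 / z) ^ 2 = -Complex.I * z * ModularForm.eta z ^ 2 := by
  have h := ModularForm.eta_comp_eq_csqrt_I_inv (x := z) hz
  simp only [Function.comp, Pi.smul_apply, Pi.mul_apply, smul_eq_mul] at h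
  have hs : ∀ w : ℂ, Complex.sqrt w ^ 2 = w := by
    intro w
    simp [Complex.sqrt, ← Complex.cpow_nat_mul]
  rw [h, mul_pow, mul_pow, inv_pow, hs, hs, Complex.inv_I]
  ring

lemma eta_add_int (z : ℂ) (n : ℤ) :
    ModularForm.eta (z + n) = Complex.exp (2 * π * Complex.I * n / 24) * ModularForm.eta z := by
  unfold ModularForm.eta
  have h : Function.Periodic.qParam 1 (z + n) = Function.Periodic.qParam 1 z := by
    simp only [Function.Periodic.qParam]
    rw [Complex.exp_eq_exp_iff_exists_int]
    exact ⟨n, by push_cast; ring⟩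
  simp only [ModularForm.eta_q, h]
  rw [← mul_assoc]
  congr 1
  simp only [Function.Periodic.qParam]
  rw [← Complex.exp_add]; congr 1; push_cast; ring

/-- `η(3z)⁶/η(z)²`. -/
def g (z : ℍ) : ℂ := ModularForm.eta (3 * z) ^ 6 / ModularForm.eta z ^ 2

/-- `η(z/3)⁶/η(z)²`. -/
def h (z : ℍ) : ℂ := ModularForm.eta (z / 3) ^ 6 / ModularForm.eta z ^ 2

/-- The eta quotient `η(9z)⁶/η(3z)²`. -/
def f (z : ℍ) : ℂ := ModularForm.eta (9 * z) ^ 6 / ModularForm.eta (3 * z) ^ 2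

/-- Cube root of unity. -/
def ζ : ℂ := Complex.exp (2 * π * Complex.I * (2 / 3))

lemma ζ_ne : ζ ≠ 0 := Complex.exp_ne_zero _

lemma ζ_zpow (n : ℤ) : ζ ^ n = Complex.exp (2 * π * Complex.I * (2 / 3) * n) := by
  rw [ζ, ← Complex.exp_int_mul]; congr 1; ring

lemma ζ_three (n : ℤ) : ζ ^ (3 * n) = 1 := by
  rw [ζ_zpow, Complex.exp_eq_one_iff]
  exact ⟨2 * n, by push_cast; ring⟩

lemma ζ_congr {m n : ℤ} (hmn : (3 : ℤ) ∣ m - n) : ζ ^ m = ζ ^ n := by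
  obtain ⟨k, hk⟩ := hmn
  rw [show m = 3 * k + n by omega, zpow_add₀ ζ_ne, ζ_three, one_mul]

lemma slash2 (F : ℍ → ℂ) (γ : SL(2, ℤ)) (z : ℍ) :
    (F ∣[(2 : ℤ)] γ) z = F (γ • z) / ((γ 1 0 : ℂ) * z + γ 1 1) ^ 2 := by
  rw [ModularForm.SL_slash_apply, ModularGroup.denom_apply, _root_.zpow_neg, div_eq_mul_inv]
  norm_cast

lemma coe_smul (γ : SL(2, ℤ)) (z : ℍ) :
    ((γ • z : ℍ) : ℂ) = ((γ 0 0 : ℂ) * z + γ 0 1) / ((γ 1 0 : ℂ) * z + γ 1 1) := by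
  rw [UpperHalfPlane.coe_specialLinearGroup_apply]; simp

lemma slash_Tn (F : ℍ → ℂ) (n : ℤ) (z : ℍ) :
    (F ∣[(2 : ℤ)] (ModularGroup.T ^ n)) z = F ((n : ℝ) +ᵥ z) := by
  rw [slash2, UpperHalfPlane.modular_T_zpow_smul]
  simp [ModularGroup.coe_T_zpow]

lemma g_T (n : ℤ) : g ∣[(2 : ℤ)] (ModularGroup.T ^ n) = (ζ ^ n) • g := by
  ext z
  rw [slash_Tn]
  simp only [g, Pi.smul_apply, smul_eq_mul, UpperHalfPlane.coe_vadd]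
  rw [show (3 : ℂ) * (((n : ℝ) : ℂ) + z) = 3 * z + ((3 * n : ℤ) : ℂ) by push_cast; ring,
    show (((n : ℝ) : ℂ) + z) = z + (n : ℂ) by push_cast; ring, eta_add_int, eta_add_int,
    mul_pow, mul_pow, ← Complex.exp_nat_mul, ← Complex.exp_nat_mul, mul_div_mul_comm,
    ← Complex.exp_sub, ζ_zpow]
  congr 2
  push_cast; ring

lemma h_T (n : ℤ) : h ∣[(2 : ℤ)] (ModularGroup.T ^ (3 * n)) = h := by
  ext z
  rw [slash_Tn]
  simp only [h, UpperHalfPlane.coe_vadd]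
  rw [show ((((3 * n : ℤ) : ℝ) : ℂ) + z) / 3 = z / 3 + (n : ℂ) by push_cast; ring,
    show ((((3 * n : ℤ) : ℝ) : ℂ) + z) = z + ((3 * n : ℤ) : ℂ) by push_cast; ring,
    eta_add_int, eta_add_int,
    mul_pow, mul_pow, ← Complex.exp_nat_mul, ← Complex.exp_nat_mul, mul_div_mul_comm,
    ← Complex.exp_sub]
  conv_rhs => rw [← one_mul (_ / _)]
  congr 1
  rw [← Complex.exp_zero]
  congr 1
  push_cast; ring

lemma g_neg_inv (w : ℍ) (z : ℂ) (hz : 0 < z.im) (hw : (w : ℂ) = -1 / z) :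
    g w = -(z ^ 2 / 27) * (ModularForm.eta (z / 3) ^ 6 / ModularForm.eta z ^ 2) := by
  have hz0 : z ≠ 0 := by rintro rfl; simp at hz
  have h3 : 0 < (z / 3).im := by simpa using hz
  have e0 := ModularForm.eta_ne_zero (z := z) hz
  rw [g, hw, show (3 : ℂ) * (-1 / z) = -1 / (z / 3) by field_simp,
    show (6 : ℕ) = 2 * 3 by rfl, pow_mul, pow_mul, eta_sq_S _ h3, eta_sq_S _ hz]
  have hI := Complex.I_ne_zero
  field_simp
  ring_nf
  simp only [Complex.I_sq]
  ring

lemma g_S : g ∣[(2 : ℤ)] ModularGroup.S = (-(1 / 27 : ℂ)) • h := by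
  ext z
  have hz0 : (z : ℂ) ≠ 0 := z.ne_zero
  rw [slash2, g_neg_inv (ModularGroup.S • z) z z.im_pos]
  · simp [ModularGroup.S, h]
    field_simp
  · rw [coe_smul]; simp [ModularGroup.S]

lemma g_S' : h ∣[(2 : ℤ)] ModularGroup.S⁻¹ = (-27 : ℂ) • g := by
  have h1 := congrArg (fun F => F ∣[(2 : ℤ)] ModularGroup.S⁻¹) g_S
  simp only [← SlashAction.slash_mul, mul_inv_cancel, SlashAction.slash_one] at h1
  rw [ModularForm.SL_smul_slash] at h1
  rw [h1, smul_smul]; norm_num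

lemma g_U (n : ℤ) : g ∣[(2 : ℤ)] (ModularGroup.S * ModularGroup.T ^ (3 * n) * ModularGroup.S⁻¹) = g := by
  rw [SlashAction.slash_mul, SlashAction.slash_mul, g_S, ModularForm.SL_smul_slash, h_T,
    ModularForm.SL_smul_slash, g_S', smul_smul]
  norm_num

lemma g_one_diag (γ : SL(2, ℤ)) (h10 : γ 1 0 = 0) (h01 : γ 0 1 = 0) :
    g ∣[(2 : ℤ)] γ = g := by
  have hd := γ.det_coe
  rw [Matrix.det_fin_two, h10] at hd
  have hd' : γ 0 0 * γ 1 1 = 1 := by linarith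
  ext z
  have : γ • z = z := by
    ext
    rw [coe_smul, h10, h01]
    rcases Int.mul_eq_one_iff_eq_one_or_neg_one.mp hd' with ⟨h1, h2⟩ | ⟨h1, h2⟩ <;> simp [h1, h2]
  rw [slash2, this, h10]
  rcases Int.mul_eq_one_iff_eq_one_or_neg_one.mp hd' with ⟨h1, h2⟩ | ⟨h1, h2⟩ <;> simp [h2]

lemma U_coe (n : ℤ) : (↑(ModularGroup.S * ModularGroup.T ^ (3 * n) * ModularGroup.S⁻¹) :
    Matrix (Fin 2) (Fin 2) ℤ) = !![1, 0; -(3 * n), 1] := by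
  rw [Matrix.SpecialLinearGroup.coe_mul, Matrix.SpecialLinearGroup.coe_mul,
    ModularGroup.coe_T_zpow, Matrix.SpecialLinearGroup.coe_inv]
  simp [ModularGroup.S, Matrix.adjugate_fin_two]

/-- balanced division -/
lemma exists_bal (a m : ℤ) (hm : m ≠ 0) : ∃ n : ℤ, 2 * |a + n * m| ≤ |m| := by
  have h := Int.emod_add_mul_ediv a m
  have h1 := Int.emod_nonneg a hm
  have h2 := Int.emod_lt_abs a hm
  by_cases hc : 2 * (a % m) ≤ |m|
  · refine ⟨-(a / m), ?_⟩
    rw [show a + -(a / m) * m = a % m by linarith, abs_of_nonneg h1]; exact hc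
  · rcases abs_cases m with ⟨e, _⟩ | ⟨e, _⟩
    · refine ⟨-(a / m) - 1, ?_⟩
      rw [show a + (-(a / m) - 1) * m = a % m - m by linarith, abs_of_neg (by omega)]; omega
    · refine ⟨-(a / m) + 1, ?_⟩
      rw [show a + (-(a / m) + 1) * m = a % m + m by linarith, abs_of_neg (by omega)]; omega

lemma g_main (N : ℕ) : ∀ γ : SL(2, ℤ), (3 : ℤ) ∣ γ 1 0 → (γ 1 0).natAbs ≤ N →
    g ∣[(2 : ℤ)] γ = (ζ ^ (γ 0 1 * γ 1 1)) • g := by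
  induction N using Nat.strong_induction_on with
  | _ N ih =>
  intro γ h3 hN
  have hd := γ.det_coe
  rw [Matrix.det_fin_two] at hd
  obtain ⟨c, hc⟩ := h3
  -- translation step
  have key : ∀ n : ℤ, g ∣[(2 : ℤ)] (ModularGroup.T ^ n * γ) =
        (ζ ^ ((ModularGroup.T ^ n * γ) 0 1 * (ModularGroup.T ^ n * γ) 1 1)) • g →
      g ∣[(2 : ℤ)] γ = (ζ ^ (γ 0 1 * γ 1 1)) • g := by
    intro n hn
    rw [SlashAction.slash_mul, g_T, ModularForm.SL_smul_slash] at hn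
    have h2 := congrArg (fun F => (ζ ^ (-n)) • F) hn
    simp only [smul_smul] at h2
    rw [← zpow_add₀ ζ_ne, neg_add_cancel, zpow_zero, one_smul] at h2
    rw [h2, ← zpow_add₀ ζ_ne]
    congr 1
    apply ζ_congr
    simp only [Matrix.SpecialLinearGroup.coe_mul, ModularGroup.coe_T_zpow, Matrix.mul_apply,
      Fin.sum_univ_two]
    simp
    have h4 : (3 : ℤ) ∣ γ 1 1 * γ 1 1 - 1 := by
      have : ¬ (3 : ℤ) ∣ γ 1 1 := by
        rintro ⟨k, hk⟩
        rw [hc, hk] at hd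
        have : 3 * (γ 0 0 * k - γ 0 1 * c) = 1 := by linarith
        omega
      have h5 : γ 1 1 % 3 = 1 ∨ γ 1 1 % 3 = 2 := by omega
      apply Int.dvd_of_emod_eq_zero
      rcases h5 with h5 | h5 <;> simp [Int.sub_emod, Int.mul_emod, h5]
    obtain ⟨k, hk⟩ := h4
    refine ⟨n * k, ?_⟩
    linear_combination n * hk
  by_cases hc0 : γ 1 0 = 0
  · -- diagonal after translation
    rw [hc0] at hd
    apply key (-(γ 0 1 * γ 1 1))
    have e01 : (ModularGroup.T ^ (-(γ 0 1 * γ 1 1)) * γ) 0 1 = 0 := by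
      simp only [Matrix.SpecialLinearGroup.coe_mul, ModularGroup.coe_T_zpow, Matrix.mul_apply,
        Fin.sum_univ_two]
      simp
      have hd' : γ 0 0 * γ 1 1 = 1 := by linarith
      rcases Int.mul_eq_one_iff_eq_one_or_neg_one.mp hd' with ⟨h1, h2⟩ | ⟨h1, h2⟩ <;> simp [h2]
    rw [g_one_diag _ _ e01, e01]
    · simp
    · simp only [Matrix.SpecialLinearGroup.coe_mul, ModularGroup.coe_T_zpow, Matrix.mul_apply,
        Fin.sum_univ_two]
      simp [hc0]
  · obtain ⟨n, hn⟩ := exists_bal (γ 0 0) (γ 1 0) hc0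
    apply key n
    set δ := ModularGroup.T ^ n * γ with hδ
    have d00 : δ 0 0 = γ 0 0 + n * γ 1 0 := by
      simp only [hδ, Matrix.SpecialLinearGroup.coe_mul, ModularGroup.coe_T_zpow, Matrix.mul_apply,
        Fin.sum_univ_two]; simp
    have d10 : δ 1 0 = γ 1 0 := by
      simp only [hδ, Matrix.SpecialLinearGroup.coe_mul, ModularGroup.coe_T_zpow, Matrix.mul_apply,
        Fin.sum_univ_two]; simp
    have d0 : δ 0 0 ≠ 0 := by
      intro h0
      have hd2 := δ.det_coe
      rw [Matrix.det_fin_two, h0, d10, hc] at hd2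
      have : 3 * (-(δ 0 1 * c)) = 1 := by linarith
      omega
    obtain ⟨m, hm⟩ := exists_bal c (δ 0 0) d0
    have hu := g_U (-m)
    have := ih ((ModularGroup.S * ModularGroup.T ^ (3 * (-m)) * ModularGroup.S⁻¹ * δ) 1 0).natAbs ?_
      (ModularGroup.S * ModularGroup.T ^ (3 * (-m)) * ModularGroup.S⁻¹ * δ) ?_ le_rfl
    · rw [SlashAction.slash_mul, hu] at this
      rw [this]
      congr 1
      apply ζ_congr
      rw [Matrix.SpecialLinearGroup.coe_mul, U_coe]
      simp only [Matrix.mul_apply, Fin.sum_univ_two]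
      simp
      exact ⟨m * δ 0 1 * δ 0 1, by ring⟩
    · rw [Matrix.SpecialLinearGroup.coe_mul, U_coe]
      simp only [Matrix.mul_apply, Fin.sum_univ_two]
      simp
      rw [d10, hc]
      rw [← d00] at hn
      rw [hc] at hn hN hc0
      refine lt_of_lt_of_le ?_ hN
      rw [show 3 * m * δ 0 0 + 3 * c = 3 * (c + m * δ 0 0) by ring]
      have : c ≠ 0 := by rintro rfl; simp at hc0
      rw [abs_mul] at hn
      zify
      rw [abs_mul, abs_mul]
      have := abs_pos.mpr this
      norm_num at hn ⊢
      linarith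
    · rw [Matrix.SpecialLinearGroup.coe_mul, U_coe]
      simp only [Matrix.mul_apply, Fin.sum_univ_two]
      simp
      rw [d10, hc]
      exact ⟨m * δ 0 0 + c, by ring⟩

lemma g_slash (γ : SL(2, ℤ)) (h3 : (3 : ℤ) ∣ γ 1 0) :
    g ∣[(2 : ℤ)] γ = (ζ ^ (γ 0 1 * γ 1 1)) • g := g_main _ γ h3 le_rfl

lemma f_eq (z : ℍ) : f z = g (sc 3 (by norm_num) z) := by
  simp only [f, g, coe_sc]; push_cast; congr 3; ring

/-- Conjugation by `diag(3,1)`. -/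
def conj3 (γ : SL(2, ℤ)) (c : ℤ) (hc : γ 1 0 = 3 * c) : SL(2, ℤ) :=
  ⟨!![γ 0 0, 3 * γ 0 1; c, γ 1 1], by
    have hd := γ.det_coe
    rw [Matrix.det_fin_two, hc] at hd
    rw [Matrix.det_fin_two_of]; linarith⟩

lemma f_slash_conj (γ : SL(2, ℤ)) (c : ℤ) (hc : γ 1 0 = 3 * c) (z : ℍ) :
    (f ∣[(2 : ℤ)] γ) z = (g ∣[(2 : ℤ)] (conj3 γ c hc)) (sc 3 (by norm_num) z) := by
  rw [slash2, slash2, f_eq]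
  congr 1
  · congr 1
    ext
    rw [coe_sc, coe_smul, coe_smul, coe_sc, hc]
    simp [conj3]
    rw [← mul_div_assoc]
    congr 1 <;> ring
  · rw [coe_sc, hc]; simp [conj3]; ring

lemma f_invariant (γ : SL(2, ℤ)) (h9 : (9 : ℤ) ∣ γ 1 0) : f ∣[(2 : ℤ)] γ = f := by
  obtain ⟨c, hc⟩ := h9
  ext z
  rw [f_slash_conj γ (3 * c) (by rw [hc]; ring), g_slash _ (by simp [conj3]), f_eq]
  simp [conj3]
  rw [mul_assoc, ζ_three, one_mul]

end EtaQuot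

namespace EtaQuot

open Topology

/-- Euler's product. -/
def P (q : ℂ) : ℂ := ∏' n : ℕ, (1 - q ^ (n + 1))

lemma P_zero : P 0 = 1 := by simp [P]

lemma P_diff : DifferentiableOn ℂ P (Metric.ball 0 1) :=
  ModularForm.differentiableOn_tprod_one_sub_pow

lemma P_tendsto : Tendsto P (𝓝 0) (𝓝 1) := by
  have h1 := (P_diff.differentiableAt (Metric.isOpen_ball.mem_nhds
    (Metric.mem_ball_self (x := (0 : ℂ)) one_pos))).continuousAt.tendsto
  rwa [P_zero] at h1

lemma P_ne_zero {q : ℂ} (hq : ‖q‖ < 1) : P q ≠ 0 := by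
  unfold P
  simp_rw [sub_eq_add_neg]
  refine tprod_one_add_ne_zero_of_summable (f := fun n : ℕ ↦ -q ^ (n + 1)) ?_ ?_
  · intro i hi
    have h1 : q ^ (i + 1) = 1 := by linear_combination -hi
    have h2 : ‖q‖ ^ (i + 1) = 1 := by rw [← norm_pow, h1, norm_one]
    exact absurd h2 (pow_lt_one₀ (norm_nonneg _) hq (by omega)).ne
  · simpa using (summable_nat_add_iff 1).mpr (summable_geometric_of_lt_one (norm_nonneg _) hq)

lemma eta_eq (z : ℂ) : ModularForm.eta z =
    Complex.exp (2 * π * Complex.I * z / 24) * P (Complex.exp (2 * π * Complex.I * z)) := by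
  unfold ModularForm.eta P
  simp [ModularForm.eta_q, Function.Periodic.qParam]

lemma P_tendsto_scaled (r : ℝ) (hr : 0 < r) :
    Tendsto (fun z : ℍ => P (Complex.exp (2 * π * Complex.I * (r * z)))) atImInfty (𝓝 1) := by
  refine P_tendsto.comp ?_
  rw [tendsto_zero_iff_norm_tendsto_zero]
  have hn : ∀ z : ℍ, ‖Complex.exp (2 * π * Complex.I * (r * z))‖ =
      Real.exp (-(2 * π * r * z.im)) := by
    intro z
    rw [Complex.norm_exp]
    congr 1
    simp
    ring
  simp_rw [hn]
  refine Real.tendsto_exp_neg_atTop_nhds_zero.comp ?_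
  exact Tendsto.const_mul_atTop (by positivity) tendsto_comap

lemma quot_bdd (r : ℝ) (hr : 0 < r) (hr' : 2 ≤ 6 * r) : IsBoundedAtImInfty
    (fun z : ℍ => ModularForm.eta (r * z) ^ 6 / ModularForm.eta z ^ 2) := by
  have h1 : Tendsto (fun z : ℍ => P (Complex.exp (2 * π * Complex.I * (r * z))) ^ 6 /
      P (Complex.exp (2 * π * Complex.I * z)) ^ 2) atImInfty (𝓝 (1 ^ 6 / 1 ^ 2)) := by
    refine ((P_tendsto_scaled r hr).pow 6).div (Tendsto.pow ?_ 2) (by norm_num)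
    simpa using P_tendsto_scaled 1 one_pos
  have h2 := h1.norm.eventually_le_const (show ‖(1 ^ 6 / 1 ^ 2 : ℂ)‖ < 2 by norm_num)
  refine Asymptotics.IsBigO.of_bound 2 ?_
  filter_upwards [h2] with z hz
  rw [eta_eq, eta_eq, mul_pow, mul_pow, mul_div_mul_comm, norm_mul, ← Complex.exp_nat_mul,
    ← Complex.exp_nat_mul, ← Complex.exp_sub, Complex.norm_exp]
  have h3 : Real.exp (((6 : ℕ) * (2 * π * Complex.I * (r * z) / 24) -
      (2 : ℕ) * (2 * π * Complex.I * z / 24) : ℂ).re) ≤ 1 := by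
    rw [Real.exp_le_one_iff]
    have : ((6 : ℕ) * (2 * π * Complex.I * (r * z) / 24) -
      (2 : ℕ) * (2 * π * Complex.I * z / 24) : ℂ) =
        (2 * π / 24 * (6 * r - 2) : ℝ) * (Complex.I * z) := by push_cast; ring
    rw [this, Complex.re_ofReal_mul]
    simp only [Complex.mul_re, Complex.I_re, Complex.I_im, UpperHalfPlane.coe_im]
    have := z.im_pos
    have h4 : 0 ≤ 2 * π / 24 * (6 * r - 2) := mul_nonneg (by positivity) (by linarith)
    nlinarith
  simp only [Pi.one_apply, norm_one, mul_one]
  calc _ ≤ 1 * 2 := mul_le_mul h3 hz (norm_nonneg _) zero_le_one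
    _ = 2 := by norm_num

lemma g_bdd : IsBoundedAtImInfty g := by
  have := quot_bdd 3 (by norm_num) (by norm_num)
  convert this using 2
  simp [g]

lemma h_bdd : IsBoundedAtImInfty h := by
  have := quot_bdd (1 / 3) (by norm_num) (by norm_num)
  convert this using 2 with z
  simp only [h]
  congr 3
  push_cast; ring

lemma bdd_sc {F : ℍ → ℂ} (hF : IsBoundedAtImInfty F) (r : ℝ) (hr : 0 < r) :
    IsBoundedAtImInfty (fun z => F (sc r hr z)) := by
  rw [isBoundedAtImInfty_iff] at hF ⊢
  obtain ⟨M, A, hA⟩ := hF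
  refine ⟨M, A / r, fun z hz => hA _ ?_⟩
  rw [im_sc]
  rwa [div_le_iff₀' hr] at hz

lemma bdd_smul {F : ℍ → ℂ} (hF : IsBoundedAtImInfty F) (c : ℂ) :
    IsBoundedAtImInfty (c • F) := by
  exact Asymptotics.IsBigO.const_smul_left hF c

lemma bdd_T {F : ℍ → ℂ} (hF : IsBoundedAtImInfty F) (n : ℤ) :
    IsBoundedAtImInfty (F ∣[(2 : ℤ)] (ModularGroup.T ^ n)) := by
  rw [isBoundedAtImInfty_iff] at hF ⊢
  obtain ⟨M, A, hA⟩ := hF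
  refine ⟨M, A, fun z hz => ?_⟩
  rw [slash_Tn]
  exact hA _ (by simpa using hz)

lemma coset (N : ℤ) (γ : SL(2, ℤ)) (hc : IsCoprime (γ 1 0) N) :
    ∃ (δ : SL(2, ℤ)) (n : ℤ), N ∣ δ 1 0 ∧ γ = δ * ModularGroup.S * ModularGroup.T ^ n := by
  obtain ⟨u, v, huv⟩ := hc
  refine ⟨γ * ModularGroup.T ^ (-(u * γ 1 1)) * ModularGroup.S⁻¹, u * γ 1 1, ?_, ?_⟩
  · rw [Matrix.SpecialLinearGroup.coe_mul, Matrix.SpecialLinearGroup.coe_mul,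
      ModularGroup.coe_T_zpow, Matrix.SpecialLinearGroup.coe_inv]
    simp [ModularGroup.S, Matrix.adjugate_fin_two, Matrix.mul_apply, Fin.sum_univ_two]
    refine ⟨-(v * γ 1 1), ?_⟩
    linear_combination (γ 1 1) * huv
  · simp [mul_assoc]

lemma g_slash_bdd (γ : SL(2, ℤ)) : IsBoundedAtImInfty (g ∣[(2 : ℤ)] γ) := by
  by_cases h3 : (3 : ℤ) ∣ γ 1 0
  · rw [g_slash γ h3]; exact bdd_smul g_bdd _
  · have hco : IsCoprime (γ 1 0) 3 :=
      ((Int.prime_three.coprime_iff_not_dvd).mpr h3).symm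
    obtain ⟨δ, n, hδ, rfl⟩ := coset 3 γ hco
    rw [SlashAction.slash_mul, SlashAction.slash_mul, g_slash δ hδ, ModularForm.SL_smul_slash,
      g_S]
    exact bdd_T (bdd_smul (bdd_smul h_bdd _) _) n

lemma f_S (z : ℍ) : (f ∣[(2 : ℤ)] ModularGroup.S) z =
    -(1 / 243 : ℂ) * h (sc (1 / 3) (by norm_num) z) := by
  have hz0 : (z : ℂ) ≠ 0 := z.ne_zero
  rw [slash2, f_eq, g_neg_inv _ (sc (1 / 3) (by norm_num) z : ℍ) (UpperHalfPlane.im_pos _)]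
  · simp only [h, ModularGroup.S, coe_sc]
    simp
    field_simp
    norm_num
    ring
  · rw [coe_sc, coe_sc, coe_smul]; simp [ModularGroup.S]
    field_simp

lemma f_slash_bdd (γ : SL(2, ℤ)) : IsBoundedAtImInfty (f ∣[(2 : ℤ)] γ) := by
  by_cases h3 : (3 : ℤ) ∣ γ 1 0
  · obtain ⟨c, hc⟩ := h3
    have := bdd_sc (g_slash_bdd (conj3 γ c hc)) 3 (by norm_num)
    convert this using 2
    exact f_slash_conj γ c hc _
  · have hco : IsCoprime (γ 1 0) 9 := by
      have : IsCoprime (γ 1 0) 3 := ((Int.prime_three.coprime_iff_not_dvd).mpr h3).symm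
      have h2 := this.mul_right this
      norm_num at h2; exact h2
    obtain ⟨δ, n, hδ, rfl⟩ := coset 9 γ hco
    rw [SlashAction.slash_mul, SlashAction.slash_mul, f_invariant δ hδ]
    refine bdd_T ?_ n
    have := bdd_smul (bdd_sc h_bdd (1 / 3) (by norm_num)) (-(1 / 243 : ℂ))
    convert this using 1
    funext z
    exact f_S z

lemma f_holo : MDifferentiable 𝓘(ℂ) 𝓘(ℂ) f := by
  rw [UpperHalfPlane.mdifferentiable_iff]
  have hd : ∀ (r : ℝ) (_ : 0 < r) (z : ℂ) (_ : 0 < z.im),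
      DifferentiableAt ℂ (fun z : ℂ => ModularForm.eta (r * z)) z := by
    intro r hr z hz
    refine DifferentiableAt.comp z (f := fun z : ℂ => (r : ℂ) * z) (g := ModularForm.eta)
      (ModularForm.differentiableAt_eta_of_mem_upperHalfPlaneSet ?_) (by fun_prop)
    show 0 < ((r : ℂ) * z).im
    rw [Complex.im_ofReal_mul]; positivity
  have : DifferentiableOn ℂ (fun z : ℂ => ModularForm.eta (9 * z) ^ 6 /
      ModularForm.eta (3 * z) ^ 2) {z | 0 < z.im} := by
    intro z hz
    have h9 := hd 9 (by norm_num) z hz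
    have h3 := hd 3 (by norm_num) z hz
    push_cast at h9 h3
    refine ((h9.pow 6).div (h3.pow 2) (pow_ne_zero _ (ModularForm.eta_ne_zero ?_))).differentiableWithinAt
    show 0 < (3 * z).im
    have : 0 < z.im := hz
    simpa using this
  refine this.congr fun z hz => ?_
  simp [f, UpperHalfPlane.ofComplex_apply_of_im_pos hz]

/-- The modular form. -/
def F : ModularForm (Gamma0 9) 2 where
  toFun := f
  slash_action_eq' γ hγ := by
    obtain ⟨δ, hδ, rfl⟩ := Subgroup.mem_map.mp hγ
    have h9 : (9 : ℤ) ∣ δ 1 0 := by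
      rw [Gamma0_mem] at hδ
      exact (ZMod.intCast_zmod_eq_zero_iff_dvd _ 9).mp hδ
    exact f_invariant δ h9
  holo' := f_holo
  bdd_at_cusps' hc := by
    rw [Subgroup.IsArithmetic.isCusp_iff_isCusp_SL2Z] at hc
    rw [OnePoint.isBoundedAt_iff_forall_SL2Z hc]
    intro γ _
    exact f_slash_bdd γ

end EtaQuot

namespace EtaQuot

open Topology Asymptotics

lemma peel (d : ℂ) (G : ℂ → ℂ) (n : ℕ) (hG : Continuous G)
    (h : (fun x => d + x * G x) =O[𝓝[≠] 0] fun x : ℂ => x ^ (n + 1)) :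
    d = 0 ∧ G =O[𝓝[≠] 0] fun x : ℂ => x ^ n := by
  have hd : d = 0 := by
    have h1 : Tendsto (fun x : ℂ => x ^ (n + 1)) (𝓝[≠] 0) (𝓝 0) := by
      have : Continuous (fun x : ℂ => x ^ (n + 1)) := by fun_prop
      have := (this.tendsto 0).mono_left (nhdsWithin_le_nhds (s := {0}ᶜ))
      simpa using this
    have h2 := h.trans_tendsto h1
    have h3 : Tendsto (fun x => d + x * G x) (𝓝[≠] 0) (𝓝 d) := by
      have : Continuous (fun x : ℂ => d + x * G x) := by fun_prop
      have := (this.tendsto 0).mono_left (nhdsWithin_le_nhds (s := {0}ᶜ))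
      simpa using this
    exact tendsto_nhds_unique h3 h2
  refine ⟨hd, ?_⟩
  subst hd
  have := (isBigO_refl (fun x : ℂ => x⁻¹) (𝓝[≠] 0)).mul h
  refine this.congr' ?_ ?_
  · filter_upwards [self_mem_nhdsWithin] with x hx
    have : x ≠ 0 := hx
    field_simp; simp
  · filter_upwards [self_mem_nhdsWithin] with x hx
    have : x ≠ 0 := hx
    field_simp
    ring

lemma poly_zero (d0 d1 d2 d3 d4 : ℂ)
    (h : (fun x => d0 + d1 * x + d2 * x ^ 2 + d3 * x ^ 3 + d4 * x ^ 4) =O[𝓝[≠] 0]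
      fun x : ℂ => x ^ 5) : d0 = 0 ∧ d1 = 0 ∧ d2 = 0 ∧ d3 = 0 ∧ d4 = 0 := by
  obtain ⟨h0, h⟩ := peel d0 (fun x => d1 + x * (d2 + x * (d3 + x * d4))) 4 (by fun_prop)
    (h.congr_left fun x => by ring)
  obtain ⟨h1, h⟩ := peel _ _ 3 (by fun_prop) h
  obtain ⟨h2, h⟩ := peel _ _ 2 (by fun_prop) h
  obtain ⟨h3, h⟩ := peel _ _ 1 (by fun_prop) h
  obtain ⟨h4, h⟩ := peel d4 (fun _ => 0) 0 (by fun_prop) (h.congr_left fun x => by ring)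
  exact ⟨h0, h1, h2, h3, h4⟩

/-- Tail of the Euler product. -/
lemma tail_bound : (fun x : ℂ => (∏' n : ℕ, (1 - x ^ (n + 4 + 1))) - 1) =O[𝓝 0]
    fun x : ℂ => x ^ 5 := by
  refine IsBigO.of_bound 4 ?_
  filter_upwards [Metric.ball_mem_nhds (0 : ℂ) (show (0 : ℝ) < 1 / 2 by norm_num)] with x hx
  have hx : ‖x‖ < 1 / 2 := by simpa using hx
  have hg : HasSum (fun n : ℕ => ‖x‖ ^ n) (1 - ‖x‖)⁻¹ :=
    hasSum_geometric_of_lt_one (norm_nonneg _) (by linarith)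
  have hs : HasSum (fun n : ℕ => ‖-x ^ (n + 4 + 1)‖) ((1 - ‖x‖)⁻¹ * ‖x‖ ^ 5) := by
    have := hg.mul_right (‖x‖ ^ 5)
    refine this.congr_fun ?_ |> fun h => h
    intro n
    rw [norm_neg, norm_pow]
    ring
  have hm := (multipliable_one_add_of_summable hs.summable).hasProd
  have hle : ‖(∏' n : ℕ, (1 + -x ^ (n + 4 + 1))) - 1‖ ≤
      Real.exp ((1 - ‖x‖)⁻¹ * ‖x‖ ^ 5) - 1 := by
    refine le_of_tendsto ((hm.sub_const 1).norm) (Eventually.of_forall fun t => ?_)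
    refine (t.norm_prod_one_add_sub_one_le _).trans ?_
    gcongr
    exact sum_le_hasSum t (fun _ _ => norm_nonneg _) hs
  simp_rw [sub_eq_add_neg] at hle ⊢
  refine hle.trans ?_
  have h1 : (1 - ‖x‖)⁻¹ ≤ 2 := by
    rw [inv_le_comm₀ (by linarith) (by norm_num)]; linarith
  have h2 : (1 - ‖x‖)⁻¹ * ‖x‖ ^ 5 ≤ 2 * ‖x‖ ^ 5 := by gcongr
  have h0 : 0 ≤ (1 - ‖x‖)⁻¹ * ‖x‖ ^ 5 := mul_nonneg (inv_nonneg.mpr (by linarith)) (by positivity)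
  have h3 : ‖x‖ ^ 5 ≤ (1 / 2) ^ 5 := by gcongr
  have h4 := Real.abs_exp_sub_one_le (x := (1 - ‖x‖)⁻¹ * ‖x‖ ^ 5)
    (by rw [abs_of_nonneg h0]; linarith)
  rw [abs_of_nonneg h0] at h4
  have h5 := le_abs_self (Real.exp ((1 - ‖x‖)⁻¹ * ‖x‖ ^ 5) - 1)
  rw [norm_pow]
  simp only [sub_eq_add_neg] at *
  linarith

lemma P_split {x : ℂ} (hx : ‖x‖ < 1) : P x =
    (1 - x) * (1 - x ^ 2) * (1 - x ^ 3) * (1 - x ^ 4) * ∏' n : ℕ, (1 - x ^ (n + 4 + 1)) := by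
  have hs : Summable (fun n : ℕ => ‖-x ^ (n + 4 + 1)‖) := by
    simpa [add_assoc] using
      (summable_nat_add_iff 5).mpr (summable_geometric_of_lt_one (norm_nonneg _) hx)
  have hm := multipliable_one_add_of_summable hs
  have := Multipliable.prod_mul_tprod_nat_mul' (f := fun n : ℕ => 1 + -x ^ (n + 1)) (k := 4) hm
  simp_rw [← sub_eq_add_neg] at this
  rw [P, ← this]
  simp [Finset.prod_range_succ]

lemma bdd_of_cont {G : ℂ → ℂ} (hG : Continuous G) : G =O[𝓝 0] fun _ : ℂ => (1 : ℂ) :=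
  (hG.tendsto 0).isBigO_one ℂ

lemma O_mul_left {E G : ℂ → ℂ} (hG : G =O[𝓝 0] fun _ : ℂ => (1 : ℂ))
    (hE : E =O[𝓝 0] fun x : ℂ => x ^ 5) :
    (fun x => G x * E x) =O[𝓝 0] fun x : ℂ => x ^ 5 := by
  simpa using hG.mul hE

lemma P_bdd : P =O[𝓝 0] fun _ : ℂ => (1 : ℂ) := P_tendsto.isBigO_one ℂ

lemma P_expand : (fun x => P x - (1 - x - x ^ 2)) =O[𝓝 0] fun x : ℂ => x ^ 5 := by
  have h1 := O_mul_left (G := fun x : ℂ => (1 - x) * (1 - x ^ 2) * (1 - x ^ 3) * (1 - x ^ 4))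
    (bdd_of_cont (by fun_prop)) tail_bound
  have h2 := O_mul_left (G := fun x : ℂ => 2 - x ^ 3 - x ^ 4 + x ^ 5)
    (bdd_of_cont (by fun_prop)) (isBigO_refl _ _)
  refine (h1.add h2).congr' ?_ EventuallyEq.rfl
  filter_upwards [Metric.ball_mem_nhds (0 : ℂ) one_pos] with x hx
  rw [P_split (by simpa using hx)]
  ring

lemma tendsto_cube : Tendsto (fun x : ℂ => x ^ 3) (𝓝 0) (𝓝 0) := by
  have : Continuous fun x : ℂ => x ^ 3 := by fun_prop
  simpa using this.tendsto 0

lemma P3_expand : (fun x => P (x ^ 3) - (1 - x ^ 3)) =O[𝓝 0] fun x : ℂ => x ^ 5 := by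
  have h1 := P_expand.comp_tendsto tendsto_cube
  have h2 : ((fun x : ℂ => x ^ 5) ∘ fun x : ℂ => x ^ 3) =O[𝓝 0] fun x : ℂ => x ^ 5 :=
    (O_mul_left (G := fun x : ℂ => x ^ 10) (bdd_of_cont (by fun_prop))
      (isBigO_refl _ _)).congr_left fun x => by simp only [Function.comp]; ring
  have h3 := O_mul_left (G := fun x : ℂ => -x) (bdd_of_cont (by fun_prop)) (isBigO_refl _ _)
  refine ((h1.trans h2).add h3).congr_left fun x => ?_
  simp only [Function.comp]; ring

/-- The one-variable function with `f = q² φ(q³)`. -/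
def φ (x : ℂ) : ℂ := P (x ^ 3) ^ 6 / P x ^ 2

lemma φ_diff : DifferentiableOn ℂ φ (Metric.ball 0 1) := by
  refine DifferentiableOn.div (DifferentiableOn.pow (P_diff.comp (by fun_prop) ?_) 6)
    (P_diff.pow 2) ?_
  · intro x hx
    simp only [Metric.mem_ball, dist_zero_right, norm_pow] at hx ⊢
    exact pow_lt_one₀ (norm_nonneg _) hx (by norm_num)
  · intro x hx
    exact pow_ne_zero _ (P_ne_zero (by simpa using hx))

/-- Taylor coefficients of `φ`. -/
def c (n : ℕ) : ℂ := iteratedDeriv n φ 0 / n.factorial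

lemma φ_hasSum {x : ℂ} (hx : ‖x‖ < 1) : HasSum (fun n => c n * x ^ n) (φ x) := by
  have := Complex.hasSum_taylorSeries_on_ball φ_diff (z := x) (by simpa using hx)
  refine this.congr_fun ?_ |> fun h => h
  intro n
  simp [c]
  ring

lemma φ_expand : (fun x => φ x - (c 0 + c 1 * x + c 2 * x ^ 2 + c 3 * x ^ 3 + c 4 * x ^ 4))
    =O[𝓝 0] fun x : ℂ => x ^ 5 := by
  have ha : AnalyticAt ℂ φ 0 := φ_diff.analyticAt (Metric.ball_mem_nhds _ one_pos)
  have := ha.hasFPowerSeriesAt.isBigO_sub_partialSum_pow 5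
  rw [← isBigO_norm_right]
  simp_rw [norm_pow]
  refine this.congr_left fun x => ?_
  simp [FormalMultilinearSeries.partialSum, Finset.sum_range_succ, c]
  ring

lemma c_vals : c 0 = 1 ∧ c 1 = 2 ∧ c 2 = 5 ∧ c 3 = 4 ∧ c 4 = 8 := by
  have hP := P_expand
  have hQ := P3_expand
  have hφ := φ_expand
  set p : ℂ → ℂ := fun x => c 0 + c 1 * x + c 2 * x ^ 2 + c 3 * x ^ 3 + c 4 * x ^ 4 with hp
  set u : ℂ → ℂ := fun x => 1 - x - x ^ 2 with hu
  have hpc : Continuous p := by fun_prop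
  have huc : Continuous u := by fun_prop
  have hPP : (fun x => P x ^ 2) =O[𝓝 0] fun _ : ℂ => (1 : ℂ) := by
    simpa using P_bdd.pow 2
  have e1 := O_mul_left hPP hφ
  have e2 : (fun x => P x ^ 2 - u x ^ 2) =O[𝓝 0] fun x : ℂ => x ^ 5 :=
    (O_mul_left (P_bdd.add (bdd_of_cont huc)) hP).congr_left fun x => by ring
  have e3 := O_mul_left (bdd_of_cont hpc) e2
  have hP3 : (fun x => P (x ^ 3)) =O[𝓝 0] fun _ : ℂ => (1 : ℂ) := P_bdd.comp_tendsto tendsto_cube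
  have hv : (fun x : ℂ => 1 - x ^ 3) =O[𝓝 0] fun _ : ℂ => (1 : ℂ) := bdd_of_cont (by fun_prop)
  have e4 : (fun x => P (x ^ 3) ^ 6 - (1 - x ^ 3) ^ 6) =O[𝓝 0] fun x : ℂ => x ^ 5 := by
    have b1 : (fun x : ℂ => P (x ^ 3) + (1 - x ^ 3)) =O[𝓝 0] fun _ : ℂ => (1 : ℂ) := hP3.add hv
    have s1 : (fun x => P (x ^ 3) ^ 2 - (1 - x ^ 3) ^ 2) =O[𝓝 0] fun x : ℂ => x ^ 5 :=
      (O_mul_left b1 hQ).congr_left fun x => by ring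
    have a2 : (fun x : ℂ => P (x ^ 3) ^ 4) =O[𝓝 0] fun _ : ℂ => (1 : ℂ) := by
      simpa using hP3.pow 4
    have a3 : (fun x : ℂ => (1 - x ^ 3) ^ 4) =O[𝓝 0] fun _ : ℂ => (1 : ℂ) :=
      bdd_of_cont (by fun_prop)
    have a4 : (fun x : ℂ => P (x ^ 3) ^ 2 * (1 - x ^ 3) ^ 2) =O[𝓝 0] fun _ : ℂ => (1 : ℂ) := by
      simpa using (hP3.pow 2).mul (hv.pow 2)
    exact (O_mul_left ((a2.add a4).add a3) s1).congr_left fun x => by ring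
  -- combine everything
  have e5 : (fun x => p x * u x ^ 2 - (1 - x ^ 3) ^ 6) =O[𝓝 0] fun x : ℂ => x ^ 5 := by
    refine ((e4.sub e1).sub e3).congr' ?_ EventuallyEq.rfl
    filter_upwards [Metric.ball_mem_nhds (0 : ℂ) one_pos] with x hx
    have hx0 : P x ≠ 0 := P_ne_zero (by simpa using hx)
    have : P x ^ 2 * φ x = P (x ^ 3) ^ 6 := by
      unfold φ; field_simp
    linear_combination -this
  have e6 := O_mul_left (G := fun x : ℂ => (c 1 + 2 * c 2 - c 3 - 2 * c 4)
      + (c 2 + 2 * c 3 - c 4) * x + (c 3 + 2 * c 4) * x ^ 2 + c 4 * x ^ 3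
      - 15 * x + 20 * x ^ 4 - 15 * x ^ 7 + 6 * x ^ 10 - x ^ 13)
    (bdd_of_cont (by fun_prop)) (isBigO_refl (fun x : ℂ => x ^ 5) (𝓝 0))
  have e7 := poly_zero (c 0 - 1) (c 1 - 2 * c 0) (c 2 - 2 * c 1 - c 0)
    (c 3 - 2 * c 2 - c 1 + 2 * c 0 + 6) (c 4 - 2 * c 3 - c 2 + 2 * c 1 + c 0)
    (((e5.sub e6).congr_left fun x => by simp only [hp, hu]; ring).mono nhdsWithin_le_nhds)
  obtain ⟨h0, h1, h2, h3, h4⟩ := e7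
  refine ⟨?_, ?_, ?_, ?_, ?_⟩
  · linear_combination h0
  · linear_combination h1 + 2 * h0
  · linear_combination h2 + 2 * h1 + 5 * h0
  · linear_combination h3 + 2 * h2 + 5 * h1 + 10 * h0
  · linear_combination h4 + 2 * h3 + 5 * h2 + 10 * h1 + 20 * h0

/-- Fourier coefficients of `f`. -/
def a (n : ℤ) : ℂ := if 2 ≤ n ∧ n % 3 = 2 then c ((n - 2) / 3).toNat else 0

lemma a_val (m : ℕ) : a (3 * m + 2) = c m := by
  unfold a
  rw [if_pos (by omega)]
  congr 1
  omega

lemma f_expand (z : ℍ) : f z = Complex.exp (2 * π * Complex.I * z) ^ 2 *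
    φ (Complex.exp (2 * π * Complex.I * z) ^ 3) := by
  have hq : ∀ n : ℕ, Complex.exp (2 * π * Complex.I * z) ^ n =
      Complex.exp (2 * π * Complex.I * (n * z)) := by
    intro n; rw [← Complex.exp_nat_mul]; congr 1; ring
  unfold f φ
  rw [eta_eq, eta_eq, mul_pow, mul_pow, mul_div_mul_comm, ← pow_mul, hq, hq, hq,
    ← Complex.exp_nat_mul, ← Complex.exp_nat_mul, ← Complex.exp_sub]
  congr 2
  · push_cast; ring_nf

lemma a_expansion : HasExpansion 1 ⇑F a := by
  intro z
  have hnorm : ‖Complex.exp (2 * π * Complex.I * z) ^ 3‖ < 1 := by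
    rw [norm_pow]
    exact pow_lt_one₀ (norm_nonneg _) (UpperHalfPlane.norm_exp_two_pi_I_lt_one z) (by norm_num)
  have h1 := (φ_hasSum hnorm).mul_left (Complex.exp (2 * π * Complex.I * z) ^ 2)
  rw [← f_expand] at h1
  have hinj : Function.Injective (fun m : ℕ => (3 * m + 2 : ℤ)) := fun m n h => by
    simp only at h; omega
  refine HasSum.tsum_eq ?_ |>.symm
  refine (hinj.hasSum_iff ?_).mp ?_
  · intro n hn
    have : a n = 0 := by
      unfold a
      rw [if_neg]
      rintro ⟨h2, h3⟩
      exact hn ⟨((n - 2) / 3).toNat, by simp only; omega⟩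
    rw [this, zero_mul]
  · refine h1.congr_fun ?_ |> fun h => h
    intro m
    simp only [Function.comp, a_val]
    rw [← pow_mul, ← Complex.exp_nat_mul, ← Complex.exp_nat_mul, mul_left_comm, ← Complex.exp_add]
    congr 2
    push_cast
    simp
    ring

end EtaQuot

/-- `η(9z)⁶/η(3z)²` is a holomorphic modular form of weight 2 for `Γ₀(9)` vanishing to order
2 at `∞`, with `q`-expansion `q² + 2q⁵ + 5q⁸ + 4q¹¹ + 8q¹⁴ + ⋯`; all exponents with nonzero
coefficient are `≡ 2 mod 3`. -/
theorem statement_17 :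
    ∃ F : ModularForm (Gamma0 9) 2,
      (∀ z : ℍ, F z = Grid.eta (9 * (z : ℂ)) ^ 6 / Grid.eta (3 * (z : ℂ)) ^ 2) ∧
      ∃ a : ℤ → ℂ, HasExpansion 1 ⇑F a ∧ (∀ n < (2 : ℤ), a n = 0) ∧
        a 2 = 1 ∧ a 5 = 2 ∧ a 8 = 5 ∧ a 11 = 4 ∧ a 14 = 8 ∧
        ∀ n : ℤ, a n ≠ 0 → n % 3 = 2 := by

  obtain ⟨h0, h1, h2, h3, h4⟩ := EtaQuot.c_vals
  refine ⟨EtaQuot.F, fun z => by rw [EtaQuot.grid_eta, EtaQuot.grid_eta]; rfl, EtaQuot.a,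
    EtaQuot.a_expansion, ?_, ?_, ?_, ?_, ?_, ?_, ?_⟩
  · intro n hn
    unfold EtaQuot.a
    rw [if_neg (by omega)]
  · simpa [h0] using EtaQuot.a_val 0
  · simpa [h1] using EtaQuot.a_val 1
  · simpa [h2] using EtaQuot.a_val 2
  · simpa [h3] using EtaQuot.a_val 3
  · simpa [h4] using EtaQuot.a_val 4
  · intro n hn
    by_contra h
    refine hn ?_
    unfold EtaQuot.a
    rw [if_neg (by tauto)]
end
end
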